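/- arXiv:0905.0355 — 7 statements merged into one kernel-verified Lean document; each statement's English description precedes it below -/
import Mathlib

section
/- Let T_R be a densely defined selfadjoint operator on a complex Hilbert space H with domain D = Dom(T_R), T_I a selfadjoint nonnegative T_R-bounded operator with Dom(T_I) ⊇ D, and T = T_R − iT_I on D. Let z ∈ ℂ with Im z > 0, so that (T − z)⁻¹ exists as a bounded operator on H. Let B : D → H be a linear map satisfying ‖Bφ‖² ≤ ⟨T_I φ, φ⟩ for all φ ∈ D (i.e. B*B ≤ T_I in the form sense), and let Q be a bounded selfadjoint operator on H. Then for all φ ∈ H: ‖B (T − z)⁻¹ Q φ‖² ≤ ‖Q (T − z)⁻¹ Q‖ · ‖φ‖²; in other words ‖B (T − z)⁻¹ Q‖ ≤ ‖Q (T − z)⁻¹ Q‖^{1/2}. -/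
open scoped InnerProductSpace

/-- (Quadratic estimate, dissipative version.) With `T = T_R − i T_I` as in
Statement 1 and `z` with `Im z > 0`, let `R = (T − z)⁻¹` be the bounded inverse of `T − z`,
let `B : D → H` satisfy `‖Bφ‖² ≤ ⟨T_I φ, φ⟩` for all `φ ∈ D`, and let `Q` be a bounded
selfadjoint operator. Then `‖B (T − z)⁻¹ Q φ‖² ≤ ‖Q (T − z)⁻¹ Q‖ ⬝ ‖φ‖²` for all `φ ∈ H`. -/
theorem stmt_2 {H : Type*} [NormedAddCommGroup H] [InnerProductSpace ℂ H] [CompleteSpace H]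
    (T_R T_I : H →ₗ.[ℂ] H)
    (hdense : Dense (T_R.domain : Set H))
    (hsaR : IsSelfAdjoint T_R)
    (hsub : T_R.domain ≤ T_I.domain)
    (hsaI : IsSelfAdjoint T_I)
    (hnonneg : ∀ φ : T_I.domain, 0 ≤ (⟪(φ : H), T_I φ⟫_ℂ).re)
    (hbound : ∃ a b : ℝ, 0 ≤ a ∧ 0 ≤ b ∧ ∀ φ : T_R.domain,
      ‖T_I ⟨(φ : H), hsub φ.2⟩‖ ≤ a * ‖T_R φ‖ + b * ‖(φ : H)‖)
    (z : ℂ) (hz : 0 < z.im)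
    -- `R` is the bounded inverse of `T − z : D → H`:
    (R : H →L[ℂ] H) (hRmem : ∀ ψ : H, R ψ ∈ T_R.domain)
    (hRright : ∀ ψ : H,
      T_R ⟨R ψ, hRmem ψ⟩ - Complex.I • T_I ⟨R ψ, hsub (hRmem ψ)⟩ - z • R ψ = ψ)
    (hRleft : ∀ φ : T_R.domain,
      R (T_R φ - Complex.I • T_I ⟨(φ : H), hsub φ.2⟩ - z • (φ : H)) = (φ : H))
    -- `B` satisfies `B*B ≤ T_I` in the form sense:
    (B : T_R.domain →ₗ[ℂ] H)
    (hB : ∀ φ : T_R.domain, ‖B φ‖ ^ 2 ≤ (⟪(φ : H), T_I ⟨(φ : H), hsub φ.2⟩⟫_ℂ).re)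
    -- `Q` is bounded and selfadjoint:
    (Q : H →L[ℂ] H) (hQ : IsSelfAdjoint Q) :
    ∀ φ : H, ‖B ⟨R (Q φ), hRmem (Q φ)⟩‖ ^ 2 ≤ ‖Q.comp (R.comp Q)‖ * ‖φ‖ ^ 2 := by
  intro φ
  have hfa := LinearPMap.adjoint_isFormalAdjoint (T := T_R) hdense
  have hadj : T_R.adjoint = T_R := hsaR
  rw [hadj] at hfa
  set u : T_R.domain := ⟨R (Q φ), hRmem (Q φ)⟩ with hu
  have hsym : (⟪(u : H), T_R u⟫_ℂ).im = 0 := by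
    have h1 : ⟪T_R u, (u : H)⟫_ℂ = ⟪(u : H), T_R u⟫_ℂ := hfa u u
    rw [← inner_conj_symm] at h1
    exact Complex.conj_eq_iff_im.mp h1
  have heq := hRright (Q φ)
  have h2 : ⟪(u : H), Q φ⟫_ℂ = ⟪(u : H), T_R u⟫_ℂ
      - Complex.I * ⟪(u : H), T_I ⟨(u : H), hsub u.2⟩⟫_ℂ - z * ((‖(u : H)‖ ^ 2 : ℝ) : ℂ) := by
    conv_lhs => rw [← heq]
    rw [inner_sub_right, inner_sub_right, inner_smul_right, inner_smul_right]
    have h3 : ⟪(u : H), (u : H)⟫_ℂ = ((‖(u : H)‖ ^ 2 : ℝ) : ℂ) := by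
      rw [inner_self_eq_norm_sq_to_K]; push_cast; rfl
    rw [← h3]
  have h4 : (⟪(u : H), Q φ⟫_ℂ).im = - (⟪(u : H), T_I ⟨(u : H), hsub u.2⟩⟫_ℂ).re
      - z.im * ‖(u : H)‖ ^ 2 := by
    rw [h2, Complex.sub_im, Complex.sub_im, hsym, Complex.im_mul_ofReal, Complex.I_mul_im]
    ring
  have h5 : ⟪(u : H), Q φ⟫_ℂ = ⟪Q.comp (R.comp Q) φ, φ⟫_ℂ :=
    (hQ.isSymmetric (u : H) φ).symm
  have h6 : |(⟪(u : H), Q φ⟫_ℂ).im| ≤ ‖Q.comp (R.comp Q)‖ * ‖φ‖ ^ 2 := by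
    rw [h5]
    calc _ ≤ ‖⟪Q.comp (R.comp Q) φ, φ⟫_ℂ‖ := Complex.abs_im_le_norm _
      _ ≤ ‖Q.comp (R.comp Q) φ‖ * ‖φ‖ := norm_inner_le_norm _ _
      _ ≤ (‖Q.comp (R.comp Q)‖ * ‖φ‖) * ‖φ‖ := by
        gcongr
        exact ContinuousLinearMap.le_opNorm _ _
      _ = _ := by ring
  have h7 := neg_abs_le (⟪(u : H), Q φ⟫_ℂ).im
  have h8 : 0 ≤ z.im * ‖(u : H)‖ ^ 2 := by positivity
  have h9 := hB u
  linarith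
end

section
/- Let I ⊂ (0, ∞) be a closed set. Then there exists R₀ > 0 such that for every R ≥ R₀ and every w with p(w) ∈ I, a trajectory of energy in I which leaves the ball of radius R cannot come back: the set {t ∈ ℝ : |x̄(t,w)| ≤ R} is an interval, i.e. if t₁ ≤ t₂ ≤ t₃, |x̄(t₁,w)| ≤ R and |x̄(t₃,w)| ≤ R, then |x̄(t₂,w)| ≤ R. -/
open scoped RealInnerProductSpace

/-- If `I ⊂ (0,∞)` is closed, there exists `R₀ > 0` such that for every
`R ≥ R₀`, a trajectory of energy in `I` which leaves the ball of radius `R` cannot come back: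
`{t : |x̄(t,w)| ≤ R}` is an interval. -/
theorem stmt_6
    (n : ℕ) (hn : 1 ≤ n) (ρ : ℝ) (hρ : 0 < ρ)
    (V₁ : EuclideanSpace ℝ (Fin n) → ℝ)
    (hV₁ : ContDiff ℝ (⊤ : ℕ∞) V₁)
    (hV₁decay : ∀ k : ℕ, ∃ C : ℝ, 0 ≤ C ∧ ∀ x,
      ‖iteratedFDeriv ℝ k V₁ x‖ ≤ C * (1 + ‖x‖ ^ 2) ^ ((-ρ - (k : ℝ)) / 2))
    (p : EuclideanSpace ℝ (Fin n) × EuclideanSpace ℝ (Fin n) → ℝ)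
    (hp : ∀ w, p w = ‖w.2‖ ^ 2 + V₁ w.1)
    (φ : ℝ → EuclideanSpace ℝ (Fin n) × EuclideanSpace ℝ (Fin n) →
      EuclideanSpace ℝ (Fin n) × EuclideanSpace ℝ (Fin n))
    (hφ₀ : ∀ w, φ 0 w = w)
    (hflow : ∀ w t, HasDerivAt (fun s => φ s w)
      ((2 : ℝ) • (φ t w).2, -gradient V₁ (φ t w).1) t) :
    ∀ I : Set ℝ, I ⊆ Set.Ioi 0 → IsClosed I →
      ∃ R₀ : ℝ, 0 < R₀ ∧ ∀ R : ℝ, R₀ ≤ R → ∀ w, p w ∈ I →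
        ∀ t₁ t₂ t₃ : ℝ, t₁ ≤ t₂ → t₂ ≤ t₃ →
          ‖(φ t₁ w).1‖ ≤ R → ‖(φ t₃ w).1‖ ≤ R → ‖(φ t₂ w).1‖ ≤ R := by
  intro I hI hIc
  have hdiff : Differentiable ℝ V₁ := hV₁.differentiable (by simp)
  -- lower bound on the energies
  obtain ⟨E, hE, hIE⟩ : ∃ E : ℝ, 0 < E ∧ ∀ e ∈ I, E ≤ e := by
    have h0 : (0 : ℝ) ∈ Iᶜ := fun h => lt_irrefl (0 : ℝ) (hI h)
    obtain ⟨ε, hε, hb⟩ := Metric.isOpen_iff.1 hIc.isOpen_compl 0 h0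
    refine ⟨ε, hε, fun e he => ?_⟩
    by_contra hlt
    push Not at hlt
    have hpos : 0 < e := hI he
    exact hb (by simpa [abs_of_pos hpos] using hlt) he
  obtain ⟨C0, hC0, hV0⟩ := hV₁decay 0
  obtain ⟨C1, hC1, hV1⟩ := hV₁decay 1
  -- choice of the radius
  have htend : Filter.Tendsto (fun r : ℝ => (8 * C0 + 4 * C1) * (1 + r ^ 2) ^ (-(ρ / 2)))
      Filter.atTop (nhds 0) := by
    have h1 : Filter.Tendsto (fun r : ℝ => 1 + r ^ 2) Filter.atTop Filter.atTop :=
      Filter.tendsto_atTop_add_const_left _ _ (Filter.tendsto_pow_atTop (by norm_num))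
    have h2 := ((tendsto_rpow_neg_atTop (half_pos hρ)).comp h1).const_mul (8 * C0 + 4 * C1)
    simpa using h2
  obtain ⟨R₁, hR₁⟩ := Filter.eventually_atTop.1
    (htend.eventually (gt_mem_nhds (show (0 : ℝ) < 8 * E by positivity)))
  refine ⟨max R₁ 1, by positivity, ?_⟩
  intro R hR w hw t₁ t₂ t₃ h12 h23 hx1 hx3
  have hRR : R₁ ≤ R := (le_max_left _ _).trans hR
  have hR0 : 0 < R := lt_of_lt_of_le one_pos ((le_max_right _ _).trans hR)
  by_contra hx2
  push Not at hx2
  have hx : ∀ t, HasDerivAt (fun s => (φ s w).1) ((2 : ℝ) • (φ t w).2) t :=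
    fun t => (hflow w t).fst
  have hξ : ∀ t, HasDerivAt (fun s => (φ s w).2) (-gradient V₁ (φ t w).1) t :=
    fun t => (hflow w t).snd
  -- conservation of energy
  have hcons : ∀ t, p (φ t w) = p w := by
    have hd : ∀ t, HasDerivAt (fun s => p (φ s w)) 0 t := by
      intro t
      have hV : HasDerivAt (fun s => V₁ (φ s w).1)
          (⟪gradient V₁ (φ t w).1, (2 : ℝ) • (φ t w).2⟫) t := by
        have := ((hdiff (φ t w).1).hasGradientAt.hasFDerivAt).comp_hasDerivAt t (hx t)
        refine HasDerivAt.congr_deriv this ?_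
        simp
      have h := ((hξ t).norm_sq).add hV
      have he : (fun s => p (φ s w)) = (fun s => ‖(φ s w).2‖ ^ 2) + fun s => V₁ (φ s w).1 := by
        funext s; simp [hp]
      rw [he]
      refine HasDerivAt.congr_deriv h ?_
      rw [inner_neg_right, inner_smul_right, real_inner_comm (φ t w).2]
      ring
    intro t
    have := is_const_of_deriv_eq_zero (fun s => (hd s).differentiableAt)
      (fun s => (hd s).deriv) t 0
    simpa [hφ₀] using this
  -- derivatives of the squared distance
  set f : ℝ → ℝ := fun s => ‖(φ s w).1‖ ^ 2 with hf
  have hf1 : ∀ t, HasDerivAt f (4 * ⟪(φ t w).1, (φ t w).2⟫) t := by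
    intro t
    have h := (hx t).norm_sq
    refine HasDerivAt.congr_deriv h ?_
    rw [inner_smul_right]; ring
  have hdf : deriv f = fun t => 4 * ⟪(φ t w).1, (φ t w).2⟫ := funext fun t => (hf1 t).deriv
  have hf2 : ∀ t, HasDerivAt (deriv f)
      (8 * ‖(φ t w).2‖ ^ 2 - 4 * ⟪(φ t w).1, gradient V₁ (φ t w).1⟫) t := by
    intro t
    rw [hdf]
    have h := ((hx t).inner ℝ (hξ t)).const_mul 4
    refine HasDerivAt.congr_deriv h ?_
    rw [inner_neg_right, real_inner_smul_left, real_inner_self_eq_norm_sq]; ring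
  have hpos : ∀ t, R < ‖(φ t w).1‖ → 0 < deriv (deriv f) t := by
    intro t ht
    rw [(hf2 t).deriv]
    set x := (φ t w).1 with hxd
    set ξ := (φ t w).2 with hξd
    have hen : E ≤ ‖ξ‖ ^ 2 + V₁ x := by
      have := hIE _ hw
      rw [← hcons t, hp] at this
      exact this
    have hsm := hR₁ ‖x‖ (hRR.trans ht.le)
    have ha : V₁ x ≤ C0 * (1 + ‖x‖ ^ 2) ^ (-(ρ / 2)) := by
      have h := hV0 x
      rw [norm_iteratedFDeriv_zero] at h
      have he : ((-ρ - ((0 : ℕ) : ℝ)) / 2) = -(ρ / 2) := by push_cast; ring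
      rw [he] at h
      exact (le_abs_self _).trans h
    have hb : ⟪x, gradient V₁ x⟫ ≤ C1 * (1 + ‖x‖ ^ 2) ^ (-(ρ / 2)) := by
      have h := hV1 x
      rw [norm_iteratedFDeriv_one] at h
      have hg : ‖gradient V₁ x‖ = ‖fderiv ℝ V₁ x‖ := by
        simp [gradient]
      have hB : 0 < 1 + ‖x‖ ^ 2 := by positivity
      have hxl : ‖x‖ ≤ (1 + ‖x‖ ^ 2) ^ (1 / 2 : ℝ) := by
        rw [← Real.sqrt_eq_rpow]
        exact Real.le_sqrt_of_sq_le (by linarith)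
      calc ⟪x, gradient V₁ x⟫ ≤ ‖x‖ * ‖gradient V₁ x‖ := real_inner_le_norm _ _
        _ ≤ (1 + ‖x‖ ^ 2) ^ (1 / 2 : ℝ) *
            (C1 * (1 + ‖x‖ ^ 2) ^ ((-ρ - ((1 : ℕ) : ℝ)) / 2)) := by
            rw [hg]
            exact mul_le_mul hxl h (norm_nonneg _) (by positivity)
        _ = C1 * ((1 + ‖x‖ ^ 2) ^ (1 / 2 : ℝ) *
              (1 + ‖x‖ ^ 2) ^ ((-ρ - ((1 : ℕ) : ℝ)) / 2)) := by ring
        _ = C1 * (1 + ‖x‖ ^ 2) ^ (-(ρ / 2)) := by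
            rw [← Real.rpow_add hB]
            congr 2
            push_cast; ring
    linarith
  -- an interior maximum
  have hfc : Continuous f := continuous_iff_continuousAt.2 fun t => (hf1 t).continuousAt
  obtain ⟨s, hs, hmax⟩ := isCompact_Icc.exists_isMaxOn ⟨t₂, h12, h23⟩
    (hfc.continuousOn (s := Set.Icc t₁ t₃))
  have hsR : R < ‖(φ s w).1‖ := by
    have h : f t₂ ≤ f s := hmax ⟨h12, h23⟩
    have : ‖(φ t₂ w).1‖ ≤ ‖(φ s w).1‖ :=
      (sq_le_sq₀ (norm_nonneg _) (norm_nonneg _)).1 h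
    linarith
  have h1s : t₁ < s := lt_of_le_of_ne hs.1 (by rintro rfl; linarith)
  have hs3 : s < t₃ := lt_of_le_of_ne hs.2 (by rintro rfl; linarith)
  have hlm : IsLocalMax f s := hmax.isLocalMax (Icc_mem_nhds h1s hs3)
  have hlmin : IsLocalMin f s :=
    isLocalMin_of_deriv_deriv_pos (hpos s hsR) hlm.deriv_eq_zero hfc.continuousAt
  have hconst : f =ᶠ[nhds s] fun _ => f s := by
    filter_upwards [hlm, hlmin] with t ha hb using le_antisymm ha hb
  have hz : deriv (deriv f) s = 0 := by
    rw [hconst.deriv.deriv_eq]; simp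
  exact absurd (hpos s hsR) (by rw [hz]; exact lt_irrefl _)
end

section
/- Let I ⊂ (0, ∞). Then p⁻¹(I) = Ω_b(I) ∪ Ω_∞⁺(I) ∪ Ω_∞⁻(I): for every w with p(w) ∈ I, at least one of the following holds: (a) the set {x̄(t,w) : t ∈ ℝ} is bounded; (b) |x̄(t,w)| → ∞ as t → +∞; (c) |x̄(t,w)| → ∞ as t → −∞. -/
open Filter
open scoped RealInnerProductSpace Topology

/-- A function which is uniformly convex above the level `K` and nondecreasing at a point
above this level tends to infinity. -/
theorem escape_aux (f g h : ℝ → ℝ) (hf : ∀ t, HasDerivAt f (g t) t)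
    (hg : ∀ t, HasDerivAt g (h t) t) (c K : ℝ) (hc : 0 < c) (hh : ∀ t, K ≤ f t → c ≤ h t)
    (t₀ : ℝ) (h0 : K < f t₀) (hg0 : 0 ≤ g t₀) : Tendsto f atTop atTop := by
  have fc : Continuous f := continuous_iff_continuousAt.2 fun t => (hf t).continuousAt
  have gc : Continuous g := continuous_iff_continuousAt.2 fun t => (hg t).continuousAt
  -- key growth estimate
  have key : ∀ b, t₀ ≤ b → (∀ s, t₀ ≤ s → s < b → K ≤ f s) →
      f t₀ + c / 2 * (b - t₀) ^ 2 ≤ f b := by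
    intro b hb hs
    have hder : ∀ t, HasDerivAt (fun s => g s - c * (s - t₀)) (h t - c) t := by
      intro t
      have h1 : HasDerivAt (fun s : ℝ => c * (s - t₀)) c t := by
        simpa using ((hasDerivAt_id t).sub_const t₀).const_mul c
      exact (hg t).sub h1
    have m1 : MonotoneOn (fun s => g s - c * (s - t₀)) (Set.Icc t₀ b) := by
      apply monotoneOn_of_deriv_nonneg (convex_Icc _ _)
      · exact (by fun_prop : Continuous (fun s => g s - c * (s - t₀))).continuousOn
      · exact fun t _ => (hder t).differentiableAt.differentiableWithinAt
      · intro t ht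
        rw [interior_Icc] at ht
        rw [(hder t).deriv]
        linarith [hh t (hs t ht.1.le ht.2)]
    have hder2 : ∀ t, HasDerivAt (fun s => f s - c / 2 * (s - t₀) ^ 2) (g t - c * (t - t₀)) t := by
      intro t
      have h1 : HasDerivAt (fun s : ℝ => c / 2 * (s - t₀) ^ 2) (c * (t - t₀)) t := by
        have := (((hasDerivAt_id t).sub_const t₀).pow 2).const_mul (c / 2)
        refine this.congr_deriv ?_
        simp
        ring
      exact (hf t).sub h1
    have m2 : MonotoneOn (fun s => f s - c / 2 * (s - t₀) ^ 2) (Set.Icc t₀ b) := by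
      apply monotoneOn_of_deriv_nonneg (convex_Icc _ _)
      · exact (by fun_prop : Continuous (fun s => f s - c / 2 * (s - t₀) ^ 2)).continuousOn
      · exact fun t _ => (hder2 t).differentiableAt.differentiableWithinAt
      · intro t ht
        rw [interior_Icc] at ht
        rw [(hder2 t).deriv]
        have := m1 (Set.left_mem_Icc.2 hb) (Set.Ioo_subset_Icc_self ht) ht.1.le
        simp only [sub_self, mul_zero, sub_zero] at this
        linarith
    have := m2 (Set.left_mem_Icc.2 hb) (Set.right_mem_Icc.2 hb) hb
    simp only [sub_self] at this
    norm_num at this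
    linarith
  have above : ∀ b, t₀ ≤ b → K < f b := by
    intro b hb
    by_contra hK
    push Not at hK
    have hcomp : IsCompact (Set.Icc t₀ b ∩ {s | f s ≤ K}) :=
      isCompact_Icc.inter_right (isClosed_le fc continuous_const)
    obtain ⟨s, ⟨hs1, hs2⟩, hs3⟩ := hcomp.exists_isLeast ⟨b, Set.right_mem_Icc.2 hb, hK⟩
    have hs2' : f s ≤ K := hs2
    have := key s hs1.1 (by
      intro u hu hus
      by_contra hlt
      push Not at hlt
      have := hs3 ⟨⟨hu, hus.le.trans hs1.2⟩, hlt.le⟩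
      linarith)
    have h3 : 0 ≤ c / 2 * (s - t₀) ^ 2 := by positivity
    linarith
  have lim : Tendsto (fun t : ℝ => f t₀ + c / 2 * (t - t₀) ^ 2) atTop atTop := by
    apply tendsto_atTop_add_const_left
    apply Tendsto.const_mul_atTop (by positivity)
    exact (tendsto_pow_atTop two_ne_zero).comp (tendsto_atTop_add_const_right _ (-t₀) tendsto_id)
  refine tendsto_atTop_mono' _ ?_ lim
  filter_upwards [eventually_ge_atTop t₀] with t ht
  exact key t ht fun s hs _ => (above s hs).le

/-- For `I ⊂ (0,∞)`, one has `p⁻¹(I) = Ω_b(I) ∪ Ω_∞⁺(I) ∪ Ω_∞⁻(I)`: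
every trajectory of energy in `I` is either bounded, or escapes to infinity in the future,
or escapes to infinity in the past. -/
theorem stmt_7
    (n : ℕ) (hn : 1 ≤ n) (ρ : ℝ) (hρ : 0 < ρ)
    (V₁ : EuclideanSpace ℝ (Fin n) → ℝ)
    (hV₁ : ContDiff ℝ (⊤ : ℕ∞) V₁)
    (hV₁decay : ∀ k : ℕ, ∃ C : ℝ, 0 ≤ C ∧ ∀ x,
      ‖iteratedFDeriv ℝ k V₁ x‖ ≤ C * (1 + ‖x‖ ^ 2) ^ ((-ρ - (k : ℝ)) / 2))
    (p : EuclideanSpace ℝ (Fin n) × EuclideanSpace ℝ (Fin n) → ℝ)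
    (hp : ∀ w, p w = ‖w.2‖ ^ 2 + V₁ w.1)
    (φ : ℝ → EuclideanSpace ℝ (Fin n) × EuclideanSpace ℝ (Fin n) →
      EuclideanSpace ℝ (Fin n) × EuclideanSpace ℝ (Fin n))
    (hφ₀ : ∀ w, φ 0 w = w)
    (hflow : ∀ w t, HasDerivAt (fun s => φ s w)
      ((2 : ℝ) • (φ t w).2, -gradient V₁ (φ t w).1) t) :
    ∀ I : Set ℝ, I ⊆ Set.Ioi 0 → ∀ w, p w ∈ I →
      (∃ M : ℝ, ∀ t : ℝ, ‖(φ t w).1‖ ≤ M) ∨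
      Tendsto (fun t : ℝ => ‖(φ t w).1‖) atTop atTop ∨
      Tendsto (fun t : ℝ => ‖(φ t w).1‖) atBot atTop := by
  intro I hI w hw
  have hE : 0 < p w := hI hw
  obtain ⟨C0, hC0, hV0⟩ := hV₁decay 0
  obtain ⟨C1, hC1, hV1⟩ := hV₁decay 1
  have hdiff : Differentiable ℝ V₁ := hV₁.differentiable (by simp)
  have hx : ∀ t, HasDerivAt (fun s => (φ s w).1) ((2 : ℝ) • (φ t w).2) t :=
    fun t => (hflow w t).fst
  have hξ : ∀ t, HasDerivAt (fun s => (φ s w).2) (-gradient V₁ (φ t w).1) t :=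
    fun t => (hflow w t).snd
  have hfd : ∀ x y, fderiv ℝ V₁ x y = ⟪gradient V₁ x, y⟫ := by
    intro x y
    simp [gradient]
  -- conservation of energy
  have hcons : ∀ t, ‖(φ t w).2‖ ^ 2 + V₁ (φ t w).1 = p w := by
    have hd : ∀ t, HasDerivAt (fun s => ‖(φ s w).2‖ ^ 2 + V₁ (φ s w).1) 0 t := by
      intro t
      have h1 := (hξ t).norm_sq
      have h2 := (hdiff (φ t w).1).hasFDerivAt.comp_hasDerivAt t (hx t)
      have h3 := h1.add h2
      refine h3.congr_deriv ?_
      rw [hfd, inner_neg_right, inner_smul_right, real_inner_comm]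
      ring
    intro t
    have := is_const_of_deriv_eq_zero (fun t => (hd t).differentiableAt)
      (fun t => (hd t).deriv) t 0
    simp only [hφ₀] at this
    rw [this, hp]
  have hf : ∀ t, HasDerivAt (fun s => ‖(φ s w).1‖ ^ 2) (4 * ⟪(φ t w).1, (φ t w).2⟫) t := by
    intro t
    refine (hx t).norm_sq.congr_deriv ?_
    rw [inner_smul_right]
    ring
  have hg : ∀ t, HasDerivAt (fun s => 4 * ⟪(φ s w).1, (φ s w).2⟫)
      (8 * ‖(φ t w).2‖ ^ 2 - 4 * ⟪(φ t w).1, gradient V₁ (φ t w).1⟫) t := by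
    intro t
    refine (((hx t).inner ℝ (hξ t)).const_mul 4).congr_deriv ?_
    rw [inner_neg_right, real_inner_smul_left, real_inner_self_eq_norm_sq]
    ring
  -- decay
  obtain ⟨K, hK⟩ : ∃ K : ℝ, ∀ r, K ≤ r → (8 * C0 + 4 * C1) * (1 + r) ^ (-(ρ / 2)) < 4 * p w := by
    have h1 : Tendsto (fun r : ℝ => (8 * C0 + 4 * C1) * (1 + r) ^ (-(ρ / 2))) atTop
        (𝓝 ((8 * C0 + 4 * C1) * 0)) :=
      ((tendsto_rpow_neg_atTop (by positivity : 0 < ρ / 2)).comp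
        (tendsto_atTop_add_const_left _ 1 tendsto_id)).const_mul _
    rw [mul_zero] at h1
    exact eventually_atTop.1 (h1.eventually (gt_mem_nhds (by linarith)))
  have hh : ∀ t, K ≤ ‖(φ t w).1‖ ^ 2 →
      4 * p w ≤ 8 * ‖(φ t w).2‖ ^ 2 - 4 * ⟪(φ t w).1, gradient V₁ (φ t w).1⟫ := by
    intro t ht
    have e := hcons t
    have k := hK _ ht
    generalize (φ t w).1 = x at *
    have a0 := hV0 x
    have a1 := hV1 x
    rw [norm_iteratedFDeriv_zero, Real.norm_eq_abs] at a0
    rw [← norm_iteratedFDeriv_fderiv, norm_iteratedFDeriv_zero] at a1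
    have hpos : 0 < 1 + ‖x‖ ^ 2 := by positivity
    have b1 : |fderiv ℝ V₁ x x| ≤ C1 * (1 + ‖x‖ ^ 2) ^ (-(ρ / 2)) := by
      have hn1 : ‖x‖ ≤ (1 + ‖x‖ ^ 2) ^ ((1 : ℝ) / 2) := by
        rw [← Real.sqrt_eq_rpow]
        exact Real.le_sqrt_of_sq_le (by linarith)
      calc |fderiv ℝ V₁ x x| ≤ ‖fderiv ℝ V₁ x‖ * ‖x‖ := (fderiv ℝ V₁ x).le_opNorm x
        _ ≤ (C1 * (1 + ‖x‖ ^ 2) ^ ((-ρ - ((1 : ℕ) : ℝ)) / 2)) * (1 + ‖x‖ ^ 2) ^ ((1 : ℝ) / 2) := by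
          gcongr
        _ = C1 * (1 + ‖x‖ ^ 2) ^ (-(ρ / 2)) := by
          rw [mul_assoc, ← Real.rpow_add hpos]
          congr 2
          push_cast
          ring
    have b0 : |V₁ x| ≤ C0 * (1 + ‖x‖ ^ 2) ^ (-(ρ / 2)) := by
      convert a0 using 3
      push_cast
      ring
    rw [hfd, real_inner_comm] at b1
    have c0 := (abs_le.1 b0).2
    have c1 := (abs_le.1 b1).2
    nlinarith
  have hsq : ∀ l : Filter ℝ, Tendsto (fun t => ‖(φ t w).1‖ ^ 2) l atTop →
      Tendsto (fun t => ‖(φ t w).1‖) l atTop := by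
    intro l h
    have := Real.tendsto_sqrt_atTop.comp h
    refine this.congr fun t => ?_
    simp [Real.sqrt_sq]
  by_cases hb : ∃ t, K < ‖(φ t w).1‖ ^ 2
  · right
    obtain ⟨t₀, ht₀⟩ := hb
    rcases le_total 0 (4 * ⟪(φ t₀ w).1, (φ t₀ w).2⟫) with hs | hs
    · left
      exact hsq _ (escape_aux _ _ _ hf hg (4 * p w) K (by linarith) hh t₀ ht₀ hs)
    · right
      have hneg : ∀ t : ℝ, HasDerivAt (fun s : ℝ => -s) (-1) t := fun t => (hasDerivAt_id t).neg
      have := escape_aux (fun t => ‖(φ (-t) w).1‖ ^ 2)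
        (fun t => -(4 * ⟪(φ (-t) w).1, (φ (-t) w).2⟫))
        (fun t => 8 * ‖(φ (-t) w).2‖ ^ 2 - 4 * ⟪(φ (-t) w).1, gradient V₁ (φ (-t) w).1⟫)
        (fun t => by
          have h1 := (hf (-t)).comp t (hneg t)
          refine h1.congr_deriv ?_
          ring)
        (fun t => by
          have h1 := ((hg (-t)).comp t (hneg t)).neg
          refine h1.congr_deriv ?_
          ring)
        (4 * p w) K (by linarith) (fun t ht => hh (-t) ht) (-t₀) (by simpa using ht₀)
        (by simp only [neg_neg]; linarith)
      apply hsq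
      have h2 := this.comp tendsto_neg_atBot_atTop
      refine h2.congr fun t => ?_
      simp
  · left
    push Not at hb
    exact ⟨Real.sqrt K, fun t => Real.le_sqrt_of_sq_le (hb t)⟩
end

section
/- If I ⊂ (0, ∞) is closed, then the trapped set Ω_b(I) = {w ∈ p⁻¹(I) : t ↦ x̄(t,w) is bounded on ℝ} is a compact subset of ℝⁿ × ℝⁿ. -/
open scoped RealInnerProductSpace

lemma ode_dist {E : Type*} [NormedAddCommGroup E] [NormedSpace ℝ E] (v : E → E) (K : NNReal)
    (hv : LipschitzWith K v) (f g : ℝ → E) (hf : ∀ t, HasDerivAt f (v (f t)) t)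
    (hg : ∀ t, HasDerivAt g (v (g t)) t) (t : ℝ) (ht : 0 ≤ t) :
    dist (f t) (g t) ≤ dist (f 0) (g 0) * Real.exp (K * t) := by
  have := dist_le_of_trajectories_ODE (v := fun _ => v) (K := K) (f := f) (g := g) (a := 0) (b := t)
    (δ := dist (f 0) (g 0)) (fun _ => hv)
    (fun s _ => (hf s).continuousAt.continuousWithinAt) (fun s _ => (hf s).hasDerivWithinAt)
    (fun s _ => (hg s).continuousAt.continuousWithinAt) (fun s _ => (hg s).hasDerivWithinAt) le_rfl
    t ⟨ht, le_rfl⟩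
  simpa using this

lemma flow_cont {E : Type*} [NormedAddCommGroup E] [NormedSpace ℝ E] (v : E → E) (K : NNReal)
    (hv : LipschitzWith K v) (φ : ℝ → E → E) (h0 : ∀ w, φ 0 w = w)
    (hφ : ∀ w t, HasDerivAt (fun s => φ s w) (v (φ t w)) t) (t : ℝ) : Continuous (φ t) := by
  rcases le_total 0 t with ht | ht
  · refine (LipschitzWith.of_dist_le_mul (K := ⟨Real.exp (K * t), (Real.exp_pos _).le⟩)
      fun a b => ?_).continuous
    have := ode_dist v K hv (fun s => φ s a) (fun s => φ s b) (hφ a) (hφ b) t ht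
    simp only [h0] at this
    rw [mul_comm]; exact this
  · refine (LipschitzWith.of_dist_le_mul (K := ⟨Real.exp (K * (-t)), (Real.exp_pos _).le⟩)
      fun a b => ?_).continuous
    have hr : ∀ w s, HasDerivAt (fun s => φ (-s) w) (-v (φ (-s) w)) s := by
      intro w s
      have := (hφ w (-s)).scomp s (hasDerivAt_neg s)
      exact this.congr_deriv (by simp)
    have := ode_dist (fun x => - v x) K (LipschitzWith.of_dist_le_mul (fun x y => by
      rw [dist_neg_neg]; exact hv.dist_le_mul x y)) (fun s => φ (-s) a) (fun s => φ (-s) b) (hr a) (hr b) (-t)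
      (by linarith)
    simp only [h0, neg_zero, neg_neg] at this
    rw [mul_comm]; exact this

lemma quad_lower (f g g' : ℝ → ℝ) (hf : ∀ t, HasDerivAt f (g t) t) (hg : ∀ t, HasDerivAt g (g' t) t)
    (c : ℝ) (t0 : ℝ) (h0 : 0 ≤ g t0) (h : ∀ t, t0 < t → c ≤ g' t) (t : ℝ) (ht : t0 ≤ t) :
    f t0 + c / 2 * (t - t0) ^ 2 ≤ f t := by
  have h1 : ∀ s, t0 ≤ s → c * (s - t0) ≤ g s := by
    have hd : ∀ s, HasDerivAt (fun s => g s - c * (s - t0)) (g' s - c) s := fun s => by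
      have := (hg s).sub (((hasDerivAt_id s).sub_const t0).const_mul c)
      exact this.congr_deriv (by simp)
    have : MonotoneOn (fun s => g s - c * (s - t0)) (Set.Ici t0) := by
      apply monotoneOn_of_deriv_nonneg (convex_Ici _)
      · exact fun s _ => (hd s).continuousAt.continuousWithinAt
      · exact fun s _ => (hd s).differentiableAt.differentiableWithinAt
      · intro s hs
        rw [(hd s).deriv]
        have := h s (by simpa using hs)
        linarith
    intro s hs
    have := this (Set.self_mem_Ici) hs hs
    simp at this; linarith
  have hd : ∀ s, HasDerivAt (fun s => f s - c / 2 * (s - t0) ^ 2) (g s - c * (s - t0)) s := fun s => by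
    have := (hf s).sub ((((hasDerivAt_id s).sub_const t0).pow 2).const_mul (c / 2))
    exact this.congr_deriv (by simp; ring)
  have : MonotoneOn (fun s => f s - c / 2 * (s - t0) ^ 2) (Set.Ici t0) := by
    apply monotoneOn_of_deriv_nonneg (convex_Ici _)
    · exact fun s _ => (hd s).continuousAt.continuousWithinAt
    · exact fun s _ => (hd s).differentiableAt.differentiableWithinAt
    · intro s hs
      rw [(hd s).deriv]
      have := h1 s (by simpa using (interior_subset hs))
      linarith
  have := this (Set.self_mem_Ici) ht ht
  simp at this; linarith

lemma escape_fwd (f g g' : ℝ → ℝ) (hf : ∀ t, HasDerivAt f (g t) t) (hg : ∀ t, HasDerivAt g (g' t) t)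
    (c r M : ℝ) (hc : 0 < c) (h : ∀ t, r < f t → c ≤ g' t) (hM : ∀ t, f t ≤ M)
    (t0 : ℝ) (h0 : 0 ≤ g t0) : f t0 ≤ r := by
  by_contra! hr
  have hloc : ∀ s t1, s < t1 → r < f s → 0 ≤ g s → ∃ t, s < t ∧ t < t1 ∧ f s < f t := by
    intro s t1 hs hrs hgs
    have hpos : ∀ᶠ t in nhdsWithin s (Set.Ioi s), 0 < g t := by
      have hsl := (hasDerivAt_iff_tendsto_slope.1 (hg s)).eventually_const_lt
        (lt_of_lt_of_le hc (h s hrs))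
      have := hsl.filter_mono (nhdsWithin_mono s (fun x (hx : s < x) => hx.ne'))
      filter_upwards [this, self_mem_nhdsWithin] with t ht hst
      have hst : s < t := hst
      rw [slope_def_field] at ht
      have := (div_pos_iff_of_pos_right (sub_pos.2 hst)).1 ht
      linarith
    obtain ⟨u, hu, hu'⟩ := (mem_nhdsGT_iff_exists_Ioo_subset).1 hpos
    have hu : s < u := hu
    have hm : StrictMonoOn f (Set.Ico s u) := by
      apply strictMonoOn_of_deriv_pos (convex_Ico _ _)
      · exact fun s _ => (hf s).continuousAt.continuousWithinAt
      · intro x hx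
        rw [(hf x).deriv]
        rw [interior_Ico] at hx
        exact hu' hx
    obtain ⟨t, ht1, ht2⟩ := exists_between (lt_min hs hu)
    exact ⟨t, ht1, ht2.trans_le (min_le_left _ _),
      hm ⟨le_rfl, hu⟩ ⟨ht1.le, ht2.trans_le (min_le_right _ _)⟩ ht1⟩
  have hge : ∀ t1, t0 ≤ t1 → f t0 ≤ f t1 := by
    intro t1 ht1
    by_contra! hlt
    obtain ⟨s, hs, hmax⟩ := isCompact_Icc.exists_isMaxOn (Set.nonempty_Icc.2 ht1)
      (f := f) (fun s _ => (hf s).continuousAt.continuousWithinAt)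
    have hfs : f t0 ≤ f s := hmax ⟨le_rfl, ht1⟩
    have hst : s < t1 := lt_of_le_of_ne hs.2 (by rintro rfl; linarith)
    have hgs : 0 ≤ g s := by
      rcases hs.1.eq_or_lt with e | e
      · rw [← e]; exact h0
      · have := (hmax.isLocalMax (Icc_mem_nhds e hst)).hasDerivAt_eq_zero (hf s)
        exact this.ge
    obtain ⟨t, a, b, hh⟩ := hloc s t1 hst (hr.trans_le hfs) hgs
    exact absurd (hmax ⟨hs.1.trans a.le, b.le⟩) (not_le.2 hh)
  have hq := quad_lower f g g' hf hg c t0 h0 (fun t ht => h t (hr.trans_le (hge t ht.le)))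
  have hMf : 0 ≤ M - f t0 := by linarith [hM t0]
  set D := (M - f t0) / c with hD
  have hD0 : 0 ≤ D := by positivity
  have h1 := hq (t0 + (2 * D + 2)) (by linarith)
  have h2 := hM (t0 + (2 * D + 2))
  have h3 : M - f t0 = c * D := by rw [hD]; field_simp
  have h4 : c / 2 * (2 * D + 2) ^ 2 ≤ c * D := by
    have : t0 + (2 * D + 2) - t0 = 2 * D + 2 := by ring
    rw [this] at h1; linarith
  nlinarith [mul_nonneg hc.le hD0, mul_nonneg (mul_nonneg hc.le hD0) hD0]

lemma escape (f g g' : ℝ → ℝ) (hf : ∀ t, HasDerivAt f (g t) t) (hg : ∀ t, HasDerivAt g (g' t) t)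
    (c r M : ℝ) (hc : 0 < c) (h : ∀ t, r < f t → c ≤ g' t) (hM : ∀ t, f t ≤ M)
    (t0 : ℝ) : f t0 ≤ r := by
  rcases le_total 0 (g t0) with h0 | h0
  · exact escape_fwd f g g' hf hg c r M hc h hM t0 h0
  · have := escape_fwd (fun t => f (-t)) (fun t => - g (-t)) (fun t => g' (-t))
      (fun t => ((hf (-t)).comp t (hasDerivAt_neg t)).congr_deriv (by simp))
      (fun t => ((hg (-t)).comp t (hasDerivAt_neg t)).neg.congr_deriv (by simp))
      c r M hc (fun t => h (-t)) (fun t => hM (-t)) (-t0) (by simpa using h0)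
    simpa using this

theorem stmt_8
    (n : ℕ) (hn : 1 ≤ n) (ρ : ℝ) (hρ : 0 < ρ)
    (V₁ : EuclideanSpace ℝ (Fin n) → ℝ)
    (hV₁ : ContDiff ℝ (⊤ : ℕ∞) V₁)
    (hV₁decay : ∀ k : ℕ, ∃ C : ℝ, 0 ≤ C ∧ ∀ x,
      ‖iteratedFDeriv ℝ k V₁ x‖ ≤ C * (1 + ‖x‖ ^ 2) ^ ((-ρ - (k : ℝ)) / 2))
    (p : EuclideanSpace ℝ (Fin n) × EuclideanSpace ℝ (Fin n) → ℝ)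
    (hp : ∀ w, p w = ‖w.2‖ ^ 2 + V₁ w.1)
    (φ : ℝ → EuclideanSpace ℝ (Fin n) × EuclideanSpace ℝ (Fin n) →
      EuclideanSpace ℝ (Fin n) × EuclideanSpace ℝ (Fin n))
    (hφ₀ : ∀ w, φ 0 w = w)
    (hflow : ∀ w t, HasDerivAt (fun s => φ s w)
      ((2 : ℝ) • (φ t w).2, -gradient V₁ (φ t w).1) t) :
    ∀ I : Set ℝ, I ⊆ Set.Ioi 0 → IsClosed I →
      IsCompact {w : EuclideanSpace ℝ (Fin n) × EuclideanSpace ℝ (Fin n) |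
        p w ∈ I ∧ ∃ M : ℝ, ∀ t : ℝ, ‖(φ t w).1‖ ≤ M} := by
  intro I hI hIc
  obtain ⟨C0, hC0, hV0⟩ := hV₁decay 0
  obtain ⟨C1, hC1, hV1⟩ := hV₁decay 1
  obtain ⟨C2, hC2, hV2⟩ := hV₁decay 2
  have hdiff : Differentiable ℝ V₁ := hV₁.differentiable (by simp)
  have hone : ∀ x : EuclideanSpace ℝ (Fin n), 1 ≤ 1 + ‖x‖ ^ 2 := fun x => by
    have := sq_nonneg ‖x‖
    linarith
  have hV0' : ∀ x, |V₁ x| ≤ C0 * (1 + ‖x‖ ^ 2) ^ (-(ρ / 2)) := fun x => by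
    have := hV0 x
    rw [norm_iteratedFDeriv_zero] at this
    convert this using 3
    simp; ring
  have hV1' : ∀ x, ‖gradient V₁ x‖ ≤ C1 * (1 + ‖x‖ ^ 2) ^ ((-ρ - 1) / 2) := fun x => by
    have := hV1 x
    rw [norm_iteratedFDeriv_one] at this
    rw [gradient, LinearIsometryEquiv.norm_map]
    simpa using this
  have hle1 : ∀ (x : EuclideanSpace ℝ (Fin n)) (e : ℝ), e ≤ 0 → (1 + ‖x‖ ^ 2) ^ e ≤ 1 :=
    fun x e he => Real.rpow_le_one_of_one_le_of_nonpos (hone x) he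
  have hgradeq : ∀ x y, ⟪gradient V₁ x, y⟫ = fderiv ℝ V₁ x y := fun x y => by
    simp [gradient]
  have hvir : ∀ x, |2 * V₁ x + ⟪x, gradient V₁ x⟫| ≤
      (2 * C0 + C1) * (1 + ‖x‖ ^ 2) ^ (-(ρ / 2)) := fun x => by
    have hx : ‖x‖ ≤ (1 + ‖x‖ ^ 2) ^ ((1 : ℝ) / 2) := by
      rw [← Real.sqrt_eq_rpow]
      exact Real.le_sqrt_of_sq_le (by linarith)
    have h1 : |⟪x, gradient V₁ x⟫| ≤ C1 * (1 + ‖x‖ ^ 2) ^ (-(ρ / 2)) := by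
      calc _ ≤ ‖x‖ * ‖gradient V₁ x‖ := abs_real_inner_le_norm _ _
        _ ≤ (1 + ‖x‖ ^ 2) ^ ((1 : ℝ) / 2) * (C1 * (1 + ‖x‖ ^ 2) ^ ((-ρ - 1) / 2)) := by
          gcongr
          exact hV1' x
        _ = C1 * ((1 + ‖x‖ ^ 2) ^ ((1 : ℝ) / 2) * (1 + ‖x‖ ^ 2) ^ ((-ρ - 1) / 2)) := by ring
        _ = _ := by
          rw [← Real.rpow_add (by linarith [hone x])]
          congr 2; ring
    calc _ ≤ |2 * V₁ x| + |⟪x, gradient V₁ x⟫| := abs_add_le _ _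
      _ ≤ _ := by
        rw [abs_mul, abs_two]
        linarith [hV0' x]
  obtain ⟨K, hK⟩ : ∃ K : NNReal, LipschitzWith K (gradient V₁) := by
    refine ⟨⟨C2, hC2⟩, ?_⟩
    have hd : Differentiable ℝ (fderiv ℝ V₁) :=
      (hV₁.fderiv_right (m := 1) (by norm_cast)).differentiable (by simp)
    have : LipschitzWith ⟨C2, hC2⟩ (fderiv ℝ V₁) := by
      apply lipschitzWith_of_nnnorm_fderiv_le hd
      intro x
      have h2 := hV2 x
      have h3 : ‖fderiv ℝ (fderiv ℝ V₁) x‖ = ‖iteratedFDeriv ℝ 2 V₁ x‖ := by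
        rw [← norm_iteratedFDeriv_fderiv, norm_iteratedFDeriv_one]
      have h4 : C2 * (1 + ‖x‖ ^ 2) ^ ((-ρ - ((2 : ℕ) : ℝ)) / 2) ≤ C2 * 1 := by
        gcongr
        apply hle1
        push_cast; linarith
      change ‖fderiv ℝ (fderiv ℝ V₁) x‖ ≤ C2
      linarith
    intro x y
    have := this x y
    simpa [gradient] using this
  have hcont : ∀ t, Continuous (φ t) := by
    intro t
    have hv : LipschitzWith (max (‖(2:ℝ)‖₊ * 1) (K * 1)) (fun w : EuclideanSpace ℝ (Fin n) × EuclideanSpace ℝ (Fin n) =>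
        ((2 : ℝ) • w.2, -gradient V₁ w.1)) :=
      ((lipschitzWith_smul (2:ℝ)).comp LipschitzWith.prod_snd).prodMk ((hK.comp LipschitzWith.prod_fst).neg)
    exact flow_cont _ _ hv φ hφ₀ hflow t
  have hpc : Continuous p := by
    have : p = fun w => ‖w.2‖ ^ 2 + V₁ w.1 := funext hp
    rw [this]
    have := hV₁.continuous
    fun_prop
  have hx : ∀ w t, HasDerivAt (fun s => (φ s w).1) ((2 : ℝ) • (φ t w).2) t := fun w t =>
    (hflow w t).fst
  have hξ : ∀ w t, HasDerivAt (fun s => (φ s w).2) (-gradient V₁ (φ t w).1) t := fun w t =>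
    (hflow w t).snd
  have hener : ∀ w t, p (φ t w) = p w := by
    intro w t
    have hd : ∀ t, HasDerivAt (fun s => p (φ s w)) 0 t := fun t => by
      have h1 := (hξ w t).norm_sq
      have h2 := (hdiff (φ t w).1).hasFDerivAt.comp_hasDerivAt t (hx w t)
      have h3 := h1.add h2
      have e : (fun s => p (φ s w)) = (fun s => ‖(φ s w).2‖ ^ 2) + (V₁ ∘ fun s => (φ s w).1) := by
        funext s; simp [hp]
      rw [e]
      refine h3.congr_deriv ?_
      rw [← hgradeq, inner_neg_right, inner_smul_right, real_inner_comm]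
      ring
    have := is_const_of_deriv_eq_zero (fun t => (hd t).differentiableAt) (fun t => (hd t).deriv) t 0
    simpa [hφ₀] using this
  have hf : ∀ w t, HasDerivAt (fun s => ‖(φ s w).1‖ ^ 2) (4 * ⟪(φ t w).1, (φ t w).2⟫) t := fun w t => by
    have := (hx w t).norm_sq
    convert this using 1
    rw [inner_smul_right]; ring
  have hg : ∀ w t, HasDerivAt (fun s => 4 * ⟪(φ s w).1, (φ s w).2⟫)
      (4 * (2 * p w - (2 * V₁ (φ t w).1 + ⟪(φ t w).1, gradient V₁ (φ t w).1⟫))) t := fun w t => by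
    have := ((hx w t).inner ℝ (hξ w t)).const_mul 4
    refine this.congr_deriv ?_
    rw [← hener w t, hp, inner_smul_left, inner_neg_right, real_inner_self_eq_norm_sq]
    simp; ring
  obtain ⟨E, hE, hEI⟩ : ∃ E > 0, ∀ y ∈ I, E ≤ y := by
    have : Iᶜ ∈ nhds (0 : ℝ) := hIc.isOpen_compl.mem_nhds (fun h => lt_irrefl (0 : ℝ) (hI h))
    obtain ⟨E, hE, hb⟩ := Metric.mem_nhds_iff.1 this
    refine ⟨E, hE, fun y hy => ?_⟩
    by_contra! hlt
    have h0 : 0 < y := hI hy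
    exact hb (by simpa [abs_of_pos h0] using hlt) hy
  obtain ⟨r, hr⟩ : ∃ r : ℝ, ∀ u, r < u → (2 * C0 + C1) * (1 + u) ^ (-(ρ / 2)) ≤ E := by
    have h1 : Filter.Tendsto (fun u : ℝ => (2 * C0 + C1) * (1 + u) ^ (-(ρ / 2))) Filter.atTop
        (nhds ((2 * C0 + C1) * 0)) :=
      ((tendsto_rpow_neg_atTop (by linarith)).comp
        (Filter.tendsto_atTop_add_const_left _ 1 Filter.tendsto_id)).const_mul _
    rw [mul_zero] at h1
    obtain ⟨r, hr⟩ := Filter.eventually_atTop.1 (h1.eventually_le_const hE)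
    exact ⟨r, fun u hu => hr u hu.le⟩
  have hbd : ∀ w, p w ∈ I → (∃ M : ℝ, ∀ t : ℝ, ‖(φ t w).1‖ ≤ M) → ∀ t, ‖(φ t w).1‖ ^ 2 ≤ r := by
    rintro w hw ⟨M, hM⟩ t
    refine escape _ _ _ (hf w) (hg w) (4 * E) r (M ^ 2) (by linarith) ?_ ?_ t
    · intro s hs
      have h1 := (abs_le.1 ((hvir (φ s w).1).trans (hr _ hs))).2
      have h2 := hEI _ hw
      linarith
    · intro s
      have := hM s
      gcongr
  have hpb : ∀ w, p w ∈ I → (∃ M : ℝ, ∀ t : ℝ, ‖(φ t w).1‖ ≤ M) → p w ≤ 2 * C0 + C1 := by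
    rintro w hw ⟨M, hM⟩
    by_contra! hlt
    have hp0 : 0 < p w := hI hw
    have := escape _ _ _ (hf w) (hg w) (4 * p w) (-1) (M ^ 2) (by linarith) (fun s _ => by
      have h1 := (abs_le.1 (hvir (φ s w).1)).2
      have h2 := mul_le_mul_of_nonneg_left (hle1 (φ s w).1 (-(ρ / 2)) (by linarith))
        (show 0 ≤ 2 * C0 + C1 by linarith)
      linarith) (fun s => by have := hM s; gcongr) 0
    have h2 := sq_nonneg ‖(φ 0 w).1‖
    linarith
  apply Metric.isCompact_of_isClosed_isBounded
  · have : {w | p w ∈ I ∧ ∃ M : ℝ, ∀ t : ℝ, ‖(φ t w).1‖ ≤ M} =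
        p ⁻¹' I ∩ ⋂ t : ℝ, {w | ‖(φ t w).1‖ ^ 2 ≤ r} := by
      ext w
      simp only [Set.mem_ofPred_eq, Set.mem_inter_iff, Set.mem_preimage, Set.mem_iInter]
      constructor
      · exact fun h => ⟨h.1, hbd w h.1 h.2⟩
      · exact fun h => ⟨h.1, √r, fun t => Real.le_sqrt_of_sq_le (h.2 t)⟩
    rw [this]
    refine (hIc.preimage hpc).inter (isClosed_iInter fun t => ?_)
    have := hcont t
    exact isClosed_le (by fun_prop) continuous_const
  · refine (Metric.isBounded_closedBall (x := 0) (r := max (√r) (√(3 * C0 + C1)))).subset ?_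
    rintro w ⟨hw, hM⟩
    rw [mem_closedBall_zero_iff, Prod.norm_def]
    apply max_le_max
    · have := hbd w hw hM 0
      rw [hφ₀] at this
      exact Real.le_sqrt_of_sq_le this
    · apply Real.le_sqrt_of_sq_le
      have h1 := hpb w hw hM
      rw [hp] at h1
      have h2 := (abs_le.1 (hV0' w.1)).1
      have h3 := mul_le_mul_of_nonneg_left (hle1 w.1 (-(ρ / 2)) (by linarith)) hC0
      linarith
end

section
/- Let V₂ : ℝⁿ → ℝ be continuous and nonnegative, and set O = {(x,ξ) ∈ ℝⁿ × ℝⁿ : V₂(x) > 0}. Let E > 0 and assume that every bounded trajectory of energy E meets O, i.e. for every w with p(w) = E such that t ↦ x̄(t,w) is bounded on ℝ, there exists t ∈ ℝ with φ^t(w) ∈ O. Then there exists ε ∈ (0, E/12] such that every bounded trajectory of energy in [E − 3ε, E + 3ε] meets O: for every w ∈ Ω_b([E − 3ε, E + 3ε]) there exists t ∈ ℝ with φ^t(w) ∈ O. -/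
open scoped RealInnerProductSpace

/-- Maximum principle: a function bounded above which is uniformly convex where it exceeds `R`
never exceeds `R`. -/
lemma aux_max (f f' f'' : ℝ → ℝ) (h1 : ∀ t, HasDerivAt f (f' t) t)
    (h2 : ∀ t, HasDerivAt f' (f'' t) t) (R c M : ℝ) (hc : 0 < c)
    (hconv : ∀ t, R < f t → c ≤ f'' t) (hM : ∀ t, f t ≤ M) (t₀ : ℝ) : f t₀ ≤ R := by
  by_contra hcon
  push Not at hcon
  obtain ⟨δ, hδ, hδc, hδR⟩ : ∃ δ : ℝ, 0 < δ ∧ 2 * δ < c ∧ R < f t₀ - δ * t₀ ^ 2 := by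
    have h : 0 < f t₀ - R := by linarith
    refine ⟨min (c / 4) ((f t₀ - R) / (2 * (1 + t₀ ^ 2))), by positivity, ?_, ?_⟩
    · have := min_le_left (c / 4) ((f t₀ - R) / (2 * (1 + t₀ ^ 2)))
      linarith
    · have h3 := min_le_right (c / 4) ((f t₀ - R) / (2 * (1 + t₀ ^ 2)))
      rw [le_div_iff₀ (by positivity)] at h3
      have h4 : 0 < min (c / 4) ((f t₀ - R) / (2 * (1 + t₀ ^ 2))) := by positivity
      nlinarith [sq_nonneg t₀]
  have hh1 : ∀ t, HasDerivAt (fun t => f t - δ * t ^ 2) (f' t - 2 * δ * t) t := by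
    intro t
    have := (h1 t).sub ((hasDerivAt_pow 2 t).const_mul δ)
    refine HasDerivAt.congr_deriv this ?_
    push_cast; ring
  have hh2 : ∀ t, HasDerivAt (fun t => f' t - 2 * δ * t) (f'' t - 2 * δ) t := by
    intro t
    have := (h2 t).sub ((hasDerivAt_id t).const_mul (2 * δ))
    refine HasDerivAt.congr_deriv this ?_
    ring
  have hcont : Continuous (fun t => f t - δ * t ^ 2) :=
    continuous_iff_continuousAt.2 fun t => (hh1 t).continuousAt
  obtain ⟨s, hs⟩ := hcont.exists_forall_ge' t₀ (by
    have hlim : Filter.Tendsto (fun t : ℝ => δ * ‖t‖ ^ 2) (Filter.cocompact ℝ) Filter.atTop :=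
      Filter.Tendsto.const_mul_atTop hδ
        ((Filter.tendsto_pow_atTop (by norm_num)).comp (tendsto_norm_cocompact_atTop (E := ℝ)))
    filter_upwards [hlim.eventually_ge_atTop (M - (f t₀ - δ * t₀ ^ 2))] with t ht
    have := hM t
    simp only [Real.norm_eq_abs, sq_abs] at ht
    linarith)
  have hs0 : f' s - 2 * δ * s = 0 :=
    IsLocalMax.hasDerivAt_eq_zero (Filter.Eventually.of_forall hs) (hh1 s)
  have hfs : R < f s := by
    have := hs t₀
    nlinarith [sq_nonneg s]
  have hpos : 0 < f'' s - 2 * δ := by linarith [hconv s hfs]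
  have hd1 : deriv (fun t => f t - δ * t ^ 2) = fun t => f' t - 2 * δ * t :=
    funext fun t => (hh1 t).deriv
  have hmin : IsLocalMin (fun t => f t - δ * t ^ 2) s := by
    apply isLocalMin_of_deriv_deriv_pos
    · rw [hd1, (hh2 s).deriv]; exact hpos
    · rw [hd1]; exact hs0
    · exact hcont.continuousAt
  have hev : (fun t => f t - δ * t ^ 2) =ᶠ[nhds s] fun _ => f s - δ * s ^ 2 := by
    filter_upwards [hmin] with t ht
    exact le_antisymm (hs t) ht
  have h3 := hev.deriv.deriv_eq
  rw [hd1, (hh2 s).deriv] at h3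
  simp at h3
  linarith

/-- Flows of a globally Lipschitz field: continuous dependence on the initial value. -/
lemma aux_dep {F : Type*} [NormedAddCommGroup F] [NormedSpace ℝ F] (v : F → F) (K : NNReal)
    (hv : LipschitzWith K v) (f g : ℝ → F) (hf : ∀ t, HasDerivAt f (v (f t)) t)
    (hg : ∀ t, HasDerivAt g (v (g t)) t) (t : ℝ) :
    dist (f t) (g t) ≤ dist (f 0) (g 0) * Real.exp (K * |t|) := by
  have key : ∀ (v : F → F) (_ : LipschitzWith K v) (f g : ℝ → F)
    (_ : ∀ t, HasDerivAt f (v (f t)) t)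
    (_ : ∀ t, HasDerivAt g (v (g t)) t) (t : ℝ) (_ : 0 ≤ t),
    dist (f t) (g t) ≤ dist (f 0) (g 0) * Real.exp (K * t) := by
    intro v hv f g hf hg t ht
    have := dist_le_of_trajectories_ODE (v := fun _ => v) (K := K) (f := f) (g := g) (a := 0)
      (b := t) (δ := dist (f 0) (g 0)) (fun _ => hv)
      (fun s _ => (hf s).continuousAt.continuousWithinAt)
      (fun s _ => (hf s).hasDerivWithinAt)
      (fun s _ => (hg s).continuousAt.continuousWithinAt)
      (fun s _ => (hg s).hasDerivWithinAt) le_rfl t ⟨ht, le_rfl⟩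
    simpa using this
  rcases le_total 0 t with ht | ht
  · rw [abs_of_nonneg ht]; exact key v hv f g hf hg t ht
  · have hrev : ∀ f : ℝ → F, (∀ t, HasDerivAt f (v (f t)) t) →
        ∀ t, HasDerivAt (fun s => f (-s)) (-v (f (-t))) t := by
      intro f hf t
      have := (hf (-t)).scomp t (hasDerivAt_neg t)
      simpa [Function.comp_def] using this
    have := key (fun x => -v x) hv.neg (fun s => f (-s)) (fun s => g (-s)) (hrev f hf) (hrev g hg)
      (-t) (by linarith)
    rw [abs_of_nonpos ht]
    simpa using this

lemma aux_grad {n : ℕ} (V : EuclideanSpace ℝ (Fin n) → ℝ) (hV : ContDiff ℝ (⊤ : ℕ∞) V)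
    (C : ℝ) (hC : 0 ≤ C) (h : ∀ x, ‖iteratedFDeriv ℝ 2 V x‖ ≤ C) :
    LipschitzWith C.toNNReal (gradient V) := by
  have hd : LipschitzWith C.toNNReal (fderiv ℝ V) := by
    apply lipschitzWith_of_nnnorm_fderiv_le (𝕜 := ℝ)
    · exact (hV.fderiv_right (m := 1) (by norm_cast)).differentiable (by norm_num)
    · intro x
      rw [← NNReal.coe_le_coe, coe_nnnorm, Real.coe_toNNReal _ hC]
      have h1 := h x
      rw [← norm_iteratedFDeriv_fderiv, ← norm_iteratedFDeriv_fderiv] at h1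
      simpa using h1
  intro x y
  have := hd x y
  simpa [gradient, LinearIsometryEquiv.edist_map] using this

lemma aux_radius (ρ : ℝ) (hρ : 0 < ρ) (A e : ℝ) (he : 0 < e) :
    ∃ R : ℝ, 0 ≤ R ∧ ∀ r, R < r → A * (1 + r ^ 2) ^ (-ρ / 2) ≤ e := by
  have h : Filter.Tendsto (fun r : ℝ => A * (1 + r ^ 2) ^ (-ρ / 2)) Filter.atTop (nhds (A * 0)) := by
    apply Filter.Tendsto.const_mul
    have h1 : Filter.Tendsto (fun r : ℝ => 1 + r ^ 2) Filter.atTop Filter.atTop :=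
      Filter.tendsto_atTop_add_const_left _ _ (Filter.tendsto_pow_atTop (by norm_num))
    have := (tendsto_rpow_neg_atTop (half_pos hρ)).comp h1
    simpa [Function.comp_def, neg_div] using this
  rw [mul_zero] at h
  obtain ⟨R, hR⟩ := Filter.eventually_atTop.1 (h.eventually_le_const he)
  exact ⟨max R 0, le_max_right _ _, fun r hr => hR r ((le_max_left _ _).trans hr.le)⟩

/-- Let `V₂` be continuous and nonnegative, `O = {(x,ξ) : V₂(x) > 0}`,
`E > 0`. If every bounded trajectory of energy `E` meets `O`, then there exists
`ε ∈ (0, E/12]` such that every bounded trajectory of energy in `[E−3ε, E+3ε]` meets `O`. -/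
theorem stmt_10
    (n : ℕ) (hn : 1 ≤ n) (ρ : ℝ) (hρ : 0 < ρ)
    (V₁ : EuclideanSpace ℝ (Fin n) → ℝ)
    (hV₁ : ContDiff ℝ (⊤ : ℕ∞) V₁)
    (hV₁decay : ∀ k : ℕ, ∃ C : ℝ, 0 ≤ C ∧ ∀ x,
      ‖iteratedFDeriv ℝ k V₁ x‖ ≤ C * (1 + ‖x‖ ^ 2) ^ ((-ρ - (k : ℝ)) / 2))
    (p : EuclideanSpace ℝ (Fin n) × EuclideanSpace ℝ (Fin n) → ℝ)
    (hp : ∀ w, p w = ‖w.2‖ ^ 2 + V₁ w.1)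
    (φ : ℝ → EuclideanSpace ℝ (Fin n) × EuclideanSpace ℝ (Fin n) →
      EuclideanSpace ℝ (Fin n) × EuclideanSpace ℝ (Fin n))
    (hφ₀ : ∀ w, φ 0 w = w)
    (hflow : ∀ w t, HasDerivAt (fun s => φ s w)
      ((2 : ℝ) • (φ t w).2, -gradient V₁ (φ t w).1) t)
    (V₂ : EuclideanSpace ℝ (Fin n) → ℝ) (hV₂cont : Continuous V₂) (hV₂nonneg : ∀ x, 0 ≤ V₂ x)
    (E : ℝ) (hE : 0 < E)
    (hmeet : ∀ w, p w = E → (∃ M : ℝ, ∀ t : ℝ, ‖(φ t w).1‖ ≤ M) →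
      ∃ t : ℝ, 0 < V₂ (φ t w).1) :
    ∃ ε : ℝ, ε ∈ Set.Ioc (0 : ℝ) (E / 12) ∧
      ∀ w, p w ∈ Set.Icc (E - 3 * ε) (E + 3 * ε) →
        (∃ M : ℝ, ∀ t : ℝ, ‖(φ t w).1‖ ≤ M) → ∃ t : ℝ, 0 < V₂ (φ t w).1 := by
  obtain ⟨C0, hC0, hV0⟩ := hV₁decay 0
  obtain ⟨C1, hC1, hV1⟩ := hV₁decay 1
  obtain ⟨C2, hC2, hV2⟩ := hV₁decay 2
  have hone : ∀ x : EuclideanSpace ℝ (Fin n), 1 ≤ 1 + ‖x‖ ^ 2 := fun x => by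
    nlinarith [sq_nonneg ‖x‖]
  have hgradnorm : ∀ x, ‖gradient V₁ x‖ = ‖fderiv ℝ V₁ x‖ := fun x => by
    simp [gradient]
  have hdiff : ∀ x, DifferentiableAt ℝ V₁ x := fun x =>
    (hV₁.differentiable (by simp)).differentiableAt
  -- bounds
  have hV0' : ∀ x, |V₁ x| ≤ C0 * (1 + ‖x‖ ^ 2) ^ (-ρ / 2) := fun x => by
    simpa using hV0 x
  have hV0b : ∀ x, |V₁ x| ≤ C0 := fun x => by
    refine (hV0' x).trans ?_
    have := Real.rpow_le_one_of_one_le_of_nonpos (hone x) (by linarith : -ρ / 2 ≤ 0)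
    nlinarith
  have hV1' : ∀ x, ‖x‖ * ‖gradient V₁ x‖ ≤ C1 * (1 + ‖x‖ ^ 2) ^ (-ρ / 2) := fun x => by
    have h1 := hV1 x
    rw [← norm_iteratedFDeriv_fderiv, norm_iteratedFDeriv_zero, ← hgradnorm] at h1
    have h0 : 0 < 1 + ‖x‖ ^ 2 := by linarith [hone x]
    have hx : ‖x‖ ≤ (1 + ‖x‖ ^ 2) ^ ((1 : ℝ) / 2) := by
      rw [← Real.sqrt_eq_rpow]
      exact Real.le_sqrt_of_sq_le (by linarith)
    calc ‖x‖ * ‖gradient V₁ x‖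
        ≤ (1 + ‖x‖ ^ 2) ^ ((1 : ℝ) / 2) * (C1 * (1 + ‖x‖ ^ 2) ^ ((-ρ - ((1 : ℕ) : ℝ)) / 2)) := by
          gcongr
      _ = C1 * ((1 + ‖x‖ ^ 2) ^ ((1 : ℝ) / 2) * (1 + ‖x‖ ^ 2) ^ ((-ρ - ((1 : ℕ) : ℝ)) / 2)) := by
          ring
      _ = C1 * (1 + ‖x‖ ^ 2) ^ (-ρ / 2) := by
          rw [← Real.rpow_add h0]; congr 2; push_cast; ring
  have hlipg : LipschitzWith C2.toNNReal (gradient V₁) := by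
    apply aux_grad V₁ hV₁ C2 hC2
    intro x
    refine (hV2 x).trans ?_
    have := Real.rpow_le_one_of_one_le_of_nonpos (hone x)
      (by push_cast; linarith : (-ρ - ((2 : ℕ) : ℝ)) / 2 ≤ 0)
    nlinarith
  -- Lipschitz Hamiltonian field
  obtain ⟨K, hK⟩ : ∃ K, LipschitzWith K
      (fun w : EuclideanSpace ℝ (Fin n) × EuclideanSpace ℝ (Fin n) =>
        ((2 : ℝ) • w.2, -gradient V₁ w.1)) :=
    ⟨_, ((lipschitzWith_smul (2 : ℝ)).comp LipschitzWith.prod_snd).prodMk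
      (hlipg.comp LipschitzWith.prod_fst).neg⟩
  have hdep : ∀ w w' t, dist (φ t w) (φ t w') ≤ dist w w' * Real.exp (K * |t|) := by
    intro w w' t
    have := aux_dep _ K hK (fun s => φ s w) (fun s => φ s w') (hflow w) (hflow w') t
    simpa [hφ₀] using this
  have hφc : ∀ t, Continuous (φ t) := by
    intro t
    refine (LipschitzWith.of_dist_le_mul (K := (Real.exp (K * |t|)).toNNReal) ?_).continuous
    intro w w'
    rw [Real.coe_toNNReal _ (Real.exp_pos _).le, mul_comm]
    exact hdep w w' t
  have hx : ∀ w t, HasDerivAt (fun s => (φ s w).1) ((2 : ℝ) • (φ t w).2) t := fun w t => by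
    have := ((ContinuousLinearMap.fst ℝ (EuclideanSpace ℝ (Fin n)) (EuclideanSpace ℝ (Fin n))).hasFDerivAt
      (x := φ t w)).comp_hasDerivAt t (hflow w t)
    exact this
  have hξ : ∀ w t, HasDerivAt (fun s => (φ s w).2) (-gradient V₁ (φ t w).1) t := fun w t => by
    have := ((ContinuousLinearMap.snd ℝ (EuclideanSpace ℝ (Fin n)) (EuclideanSpace ℝ (Fin n))).hasFDerivAt
      (x := φ t w)).comp_hasDerivAt t (hflow w t)
    exact this
  -- energy conservation
  have hen : ∀ w t, p (φ t w) = p w := by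
    intro w t
    have hder : ∀ t, HasDerivAt (fun s => p (φ s w)) 0 t := by
      intro t
      have h1 := (hξ w t).norm_sq
      have h2 := ((hdiff (φ t w).1).hasGradientAt.hasFDerivAt).comp_hasDerivAt t (hx w t)
      have h3 := h1.add h2
      have h4 : (fun s => p (φ s w)) = fun s => ‖(φ s w).2‖ ^ 2 + V₁ (φ s w).1 :=
        funext fun s => hp _
      rw [h4]
      refine HasDerivAt.congr_deriv h3 ?_
      simp
    have := is_const_of_deriv_eq_zero (fun t => (hder t).differentiableAt)
      (fun t => (hder t).deriv) t 0
    simpa [hφ₀] using this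
  -- a-priori bound
  obtain ⟨R, hR0, hR⟩ := aux_radius ρ hρ (8 * C0 + 4 * C1) E hE
  have hbound : ∀ w, 3 * E / 4 ≤ p w → (∃ M : ℝ, ∀ t : ℝ, ‖(φ t w).1‖ ≤ M) →
      ∀ t, ‖(φ t w).1‖ ≤ R := by
    rintro w hw ⟨M, hM⟩ t
    have h := aux_max (fun t => ‖(φ t w).1‖ ^ 2)
      (fun t => 2 * ⟪(φ t w).1, (2 : ℝ) • (φ t w).2⟫)
      (fun t => 2 * (⟪(φ t w).1, (2 : ℝ) • (-gradient V₁ (φ t w).1)⟫ +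
        ⟪(2 : ℝ) • (φ t w).2, (2 : ℝ) • (φ t w).2⟫))
      (fun t => (hx w t).norm_sq)
      (fun t => ((hx w t).inner ℝ ((hξ w t).const_smul (2 : ℝ))).const_mul 2)
      (R ^ 2) E (M ^ 2) hE ?_ ?_ t
    · exact le_of_sq_le_sq h hR0
    · intro t ht
      have hlt : R < ‖(φ t w).1‖ := lt_of_pow_lt_pow_left₀ 2 (norm_nonneg _) ht
      have h1 := hR _ hlt
      have h2 := hV0' (φ t w).1
      have h3 := hV1' (φ t w).1
      have h4 := hen w t
      rw [hp] at h4
      have h5 := real_inner_le_norm (φ t w).1 (gradient V₁ (φ t w).1)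
      have h6 := le_abs_self (V₁ (φ t w).1)
      simp only [inner_smul_left, inner_smul_right, inner_neg_right, real_inner_self_eq_norm_sq,
        conj_trivial]
      nlinarith
    · intro t
      have := hM t
      gcongr
  -- compactness
  by_contra hcon
  push Not at hcon
  have hseq : ∀ k : ℕ, ∃ w, p w ∈ Set.Icc (E - 3 * (E / (12 * (k + 1)))) (E + 3 * (E / (12 * (k + 1)))) ∧
      (∃ M : ℝ, ∀ t : ℝ, ‖(φ t w).1‖ ≤ M) ∧ ∀ t, V₂ (φ t w).1 ≤ 0 := by
    intro k
    refine hcon (E / (12 * (k + 1))) ⟨by positivity, ?_⟩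
    gcongr
    have : (0 : ℝ) ≤ k := by positivity
    linarith
  choose w hwp hwb hwV using hseq
  have hek : ∀ k : ℕ, 3 * (E / (12 * ((k : ℝ) + 1))) ≤ E / 4 := by
    intro k
    have : E / (12 * ((k : ℝ) + 1)) ≤ E / 12 := by
      gcongr
      have : (0 : ℝ) ≤ k := by positivity
      linarith
    linarith
  have hwR : ∀ k t, ‖(φ t (w k)).1‖ ≤ R := fun k =>
    hbound (w k) (by linarith [(hwp k).1, hek k]) (hwb k)
  have hmem : ∀ k, w k ∈ Metric.closedBall (0 : EuclideanSpace ℝ (Fin n)) R ×ˢ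
      Metric.closedBall (0 : EuclideanSpace ℝ (Fin n)) (2 * E + C0 + 1) := by
    intro k
    refine ⟨?_, ?_⟩
    · have := hwR k 0
      rw [hφ₀] at this
      simpa using this
    · rw [mem_closedBall_zero_iff]
      have h1 := hp (w k)
      have h2 := (hwp k).2
      have h3 := hek k
      have h4 := (abs_le.1 (hV0b (w k).1)).1
      nlinarith [norm_nonneg (w k).2]
  obtain ⟨z, -, σ, hσ, hlim⟩ :=
    ((isCompact_closedBall (0 : EuclideanSpace ℝ (Fin n)) R).prod
      (isCompact_closedBall (0 : EuclideanSpace ℝ (Fin n)) (2 * E + C0 + 1))).tendsto_subseq hmem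
  have hpc : Continuous p := by
    have : p = fun w => ‖w.2‖ ^ 2 + V₁ w.1 := funext hp
    rw [this]
    have := hV₁.continuous
    fun_prop
  have hpE : Filter.Tendsto (fun k => p (w k)) Filter.atTop (nhds E) := by
    have h0 : Filter.Tendsto (fun k : ℕ => 3 * (E / (12 * ((k : ℝ) + 1)))) Filter.atTop (nhds 0) := by
      have := (tendsto_one_div_add_atTop_nhds_zero_nat (𝕜 := ℝ)).const_mul (E / 4)
      rw [mul_zero] at this
      refine this.congr fun k => ?_
      field_simp
      ring
    refine tendsto_of_tendsto_of_tendsto_of_le_of_le (g := fun k : ℕ => E - 3 * (E / (12 * ((k : ℝ) + 1))))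
      (h := fun k : ℕ => E + 3 * (E / (12 * ((k : ℝ) + 1)))) ?_ ?_
      (fun k => (hwp k).1) (fun k => (hwp k).2)
    · simpa using h0.const_sub E
    · simpa using h0.const_add E
  have hzE : p z = E :=
    tendsto_nhds_unique ((hpc.tendsto z).comp hlim) (hpE.comp hσ.tendsto_atTop)
  obtain ⟨t, ht⟩ := hmeet z hzE ⟨R, fun t => by
    have hc : Continuous fun w => ‖(φ t w).1‖ := (hφc t).fst.norm
    exact le_of_tendsto ((hc.tendsto z).comp hlim) (Filter.Eventually.of_forall fun k => hwR _ t)⟩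
  have hc : Continuous fun w => V₂ (φ t w).1 := hV₂cont.comp (hφc t).fst
  have := le_of_tendsto ((hc.tendsto z).comp hlim) (Filter.Eventually.of_forall fun k => hwV _ t)
  linarith
end

section
/- Let I ⊂ (0, ∞) be open with closure contained in (0, ∞), and let K be a compact subset of Ω_∞⁺(I) = {w ∈ p⁻¹(I) : |x̄(t,w)| → ∞ as t → +∞}. Then there exists T ≥ 0 such that for every w ∈ ℝⁿ × ℝⁿ the set {t ≥ 0 : φ^t(w) ∈ K} is contained in an interval of length T, i.e. there exists τ_w ≥ 0 with {t ≥ 0 : φ^t(w) ∈ K} ⊆ [τ_w, τ_w + T]. -/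
open Filter
open scoped RealInnerProductSpace Topology

/-- One-dimensional convexity barrier. -/
lemma barrier_aux (f g h : ℝ → ℝ) (c t₀ : ℝ)
    (hf : ∀ t, HasDerivAt f (g t) t) (hg : ∀ t, HasDerivAt g (h t) t)
    (hh : ∀ t, c ≤ f t → 0 ≤ h t) (h0 : c < f t₀) (g0 : 0 ≤ g t₀) :
    ∀ t, t₀ ≤ t → c < f t := by
  intro t1 ht1
  by_contra hcon
  push Not at hcon
  have hfc : Continuous f := continuous_iff_continuousAt.2 fun t => (hf t).continuousAt
  have hgc : Continuous g := continuous_iff_continuousAt.2 fun t => (hg t).continuousAt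
  have hS : IsCompact (Set.Icc t₀ t1 ∩ {t | f t ≤ c}) :=
    isCompact_Icc.inter_right (isClosed_le hfc continuous_const)
  obtain ⟨s, ⟨⟨hs1, hs2⟩, hs3⟩, hmin⟩ := hS.exists_isLeast ⟨t1, ⟨ht1, le_rfl⟩, hcon⟩
  have hs3 : f s ≤ c := hs3
  have hlt : ∀ t ∈ Set.Ico t₀ s, c < f t := by
    intro t ht
    by_contra hc
    push Not at hc
    have := hmin ⟨⟨ht.1, by linarith [ht.2]⟩, hc⟩
    linarith [ht.2]
  have hgm : MonotoneOn g (Set.Icc t₀ s) := by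
    apply monotoneOn_of_deriv_nonneg (convex_Icc _ _) hgc.continuousOn
    · intro t _
      exact (hg t).differentiableAt.differentiableWithinAt
    · intro t ht
      rw [interior_Icc] at ht
      rw [(hg t).deriv]
      exact hh t (hlt t ⟨ht.1.le, ht.2⟩).le
  have hfm : MonotoneOn f (Set.Icc t₀ s) := by
    apply monotoneOn_of_deriv_nonneg (convex_Icc _ _) hfc.continuousOn
    · intro t _
      exact (hf t).differentiableAt.differentiableWithinAt
    · intro t ht
      rw [interior_Icc] at ht
      rw [(hf t).deriv]
      exact g0.trans (hgm ⟨le_rfl, hs1⟩ ⟨ht.1.le, ht.2.le⟩ ht.1.le)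
  have := hfm ⟨le_rfl, hs1⟩ ⟨hs1, le_rfl⟩ hs1
  linarith

/-- A function tending to infinity has an outgoing time. -/
lemma outgoing_aux (f g : ℝ → ℝ) (c : ℝ)
    (hf : ∀ t, HasDerivAt f (g t) t) (hlim : Tendsto f atTop atTop) :
    ∃ t, 0 ≤ t ∧ c < f t ∧ 0 < g t := by
  obtain ⟨a, ha⟩ := eventually_atTop.1 ((hlim.eventually_gt_atTop c))
  set b := max a 0 with hb
  obtain ⟨d, hd1, hd2⟩ := ((hlim.eventually_gt_atTop (f b)).and (eventually_gt_atTop b)).exists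
  obtain ⟨e, he, hee⟩ := exists_hasDerivAt_eq_slope f g hd2
    (continuous_iff_continuousAt.2 fun t => (hf t).continuousAt).continuousOn (fun t _ => hf t)
  refine ⟨e, (le_max_right a 0).trans he.1.le, ha e ((le_max_left a 0).trans he.1.le), ?_⟩
  rw [hee]
  exact div_pos (by linarith) (by linarith)

/-- Let `I ⊂ (0,∞)` be open with closure contained in `(0,∞)`, and `K` a
compact subset of `Ω_∞⁺(I)`. Then there is `T ≥ 0` such that for every `w`, the set
`{t ≥ 0 : φ^t(w) ∈ K}` is contained in an interval `[τ_w, τ_w + T]` with `τ_w ≥ 0`. -/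
theorem stmt_13
    (n : ℕ) (hn : 1 ≤ n) (ρ : ℝ) (hρ : 0 < ρ)
    (V₁ : EuclideanSpace ℝ (Fin n) → ℝ)
    (hV₁ : ContDiff ℝ (⊤ : ℕ∞) V₁)
    (hV₁decay : ∀ k : ℕ, ∃ C : ℝ, 0 ≤ C ∧ ∀ x,
      ‖iteratedFDeriv ℝ k V₁ x‖ ≤ C * (1 + ‖x‖ ^ 2) ^ ((-ρ - (k : ℝ)) / 2))
    (p : EuclideanSpace ℝ (Fin n) × EuclideanSpace ℝ (Fin n) → ℝ)
    (hp : ∀ w, p w = ‖w.2‖ ^ 2 + V₁ w.1)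
    (φ : ℝ → EuclideanSpace ℝ (Fin n) × EuclideanSpace ℝ (Fin n) →
      EuclideanSpace ℝ (Fin n) × EuclideanSpace ℝ (Fin n))
    (hφ₀ : ∀ w, φ 0 w = w)
    (hflow : ∀ w t, HasDerivAt (fun s => φ s w)
      ((2 : ℝ) • (φ t w).2, -gradient V₁ (φ t w).1) t) :
    ∀ I : Set ℝ, IsOpen I → closure I ⊆ Set.Ioi 0 →
      ∀ K : Set (EuclideanSpace ℝ (Fin n) × EuclideanSpace ℝ (Fin n)), IsCompact K →
        K ⊆ {w | p w ∈ I ∧ Tendsto (fun t : ℝ => ‖(φ t w).1‖) atTop atTop} →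
        ∃ T : ℝ, 0 ≤ T ∧ ∀ w, ∃ τ : ℝ, 0 ≤ τ ∧
          ∀ t : ℝ, 0 ≤ t → φ t w ∈ K → t ∈ Set.Icc τ (τ + T) := by
  intro I _ hI K hK hKsub
  -- derivative of the potential
  have hdiff : Differentiable ℝ V₁ := hV₁.differentiable (by simp)
  have hgrad : ∀ x v, fderiv ℝ V₁ x v = ⟪gradient V₁ x, v⟫ := by
    intro x v
    rw [← toDual_gradient, InnerProductSpace.toDual_apply_apply]
  have hgnorm : ∀ x, ‖gradient V₁ x‖ = ‖iteratedFDeriv ℝ 1 V₁ x‖ := by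
    intro x
    rw [norm_iteratedFDeriv_one, ← toDual_gradient, LinearIsometryEquiv.norm_map]
  -- global Lipschitz bound
  obtain ⟨L, hL⟩ : ∃ L : NNReal, LipschitzWith L (gradient V₁) := by
    obtain ⟨C, hC0, hC⟩ := hV₁decay 2
    refine ⟨C.toNNReal, ?_⟩
    have h1 : LipschitzWith C.toNNReal (fderiv ℝ V₁) := by
      apply lipschitzWith_of_nnnorm_fderiv_le (𝕜 := ℝ)
      · exact (hV₁.fderiv_right (m := 1) (by norm_cast)).differentiable (by simp)
      · intro x
        rw [← NNReal.coe_le_coe, coe_nnnorm, Real.coe_toNNReal C hC0]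
        rw [← norm_iteratedFDeriv_one, norm_iteratedFDeriv_fderiv]
        refine (hC x).trans ?_
        have : (1 + ‖x‖ ^ 2) ^ ((-ρ - ((2 : ℕ) : ℝ)) / 2) ≤ 1 :=
          Real.rpow_le_one_of_one_le_of_nonpos (by nlinarith [sq_nonneg ‖x‖]) (by push_cast; linarith)
        nlinarith
    have h2 := (InnerProductSpace.toDual ℝ (EuclideanSpace ℝ (Fin n))).symm.lipschitz.comp h1
    rw [one_mul] at h2
    exact h2
  let v : EuclideanSpace ℝ (Fin n) × EuclideanSpace ℝ (Fin n) →
      EuclideanSpace ℝ (Fin n) × EuclideanSpace ℝ (Fin n) :=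
    fun w => ((2 : ℝ) • w.2, -gradient V₁ w.1)
  obtain ⟨M, hM⟩ : ∃ M : NNReal, LipschitzWith M v :=
    ⟨_, ((lipschitzWith_smul (2 : ℝ)).comp LipschitzWith.prod_snd).prodMk
      ((hL.comp LipschitzWith.prod_fst).neg)⟩
  have hcont : ∀ w, Continuous fun t => φ t w := fun w =>
    continuous_iff_continuousAt.2 fun t => (hflow w t).continuousAt
  -- group property
  have hgroup : ∀ w s t, φ (s + t) w = φ s (φ t w) := by
    intro w s t
    have := ODE_solution_unique_univ (v := fun _ => v) (s := fun _ => Set.univ) (K := M)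
      (f := fun s => φ (s + t) w) (g := fun s => φ s (φ t w)) (t₀ := 0)
      (fun _ => hM.lipschitzOnWith)
      (fun r => ⟨(hflow w (r + t)).comp_add_const r t, trivial⟩)
      (fun r => ⟨hflow _ r, trivial⟩) (by simp [hφ₀])
    exact congrFun this s
  -- continuity in the initial condition
  have hcontw : ∀ t, 0 ≤ t → Continuous fun w => φ t w := by
    intro t ht
    have : LipschitzWith ⟨Real.exp (M * (t - 0)), (Real.exp_pos _).le⟩ (fun w => φ t w) := by
      apply LipschitzWith.of_dist_le_mul
      intro a b
      have := dist_le_of_trajectories_ODE (v := fun _ => v) (K := M)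
        (f := fun s => φ s a) (g := fun s => φ s b) (a := 0) (b := t) (δ := dist a b)
        (fun _ => hM) (hcont a).continuousOn (fun s _ => (hflow a s).hasDerivWithinAt)
        (hcont b).continuousOn (fun s _ => (hflow b s).hasDerivWithinAt)
        (by simp [hφ₀]) t ⟨ht, le_rfl⟩
      rw [mul_comm] at this
      exact this
    exact this.continuous
  have hx : ∀ w t, HasDerivAt (fun s => (φ s w).1) ((2 : ℝ) • (φ t w).2) t := by
    intro w t
    have := HasFDerivAt.comp_hasDerivAt (l := Prod.fst) t (hasFDerivAt_fst (𝕜 := ℝ) (p := φ t w)) (hflow w t)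
    exact this
  have hξ : ∀ w t, HasDerivAt (fun s => (φ s w).2) (-gradient V₁ (φ t w).1) t := by
    intro w t
    have := HasFDerivAt.comp_hasDerivAt (l := Prod.snd) t (hasFDerivAt_snd (𝕜 := ℝ) (p := φ t w)) (hflow w t)
    exact this
  -- energy conservation
  have hen : ∀ w t, p (φ t w) = p w := by
    intro w t
    have hd : ∀ t, HasDerivAt (fun s => p (φ s w)) 0 t := by
      intro t
      have h1 := (hξ w t).norm_sq.add ((hdiff (φ t w).1).hasFDerivAt.comp_hasDerivAt t (hx w t))
      have h2 : (fun s => p (φ s w)) =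
          (fun s => ‖(φ s w).2‖ ^ 2) + (V₁ ∘ fun s => (φ s w).1) := by
        funext s
        simp [hp]
      rw [h2]
      refine h1.congr_deriv ?_
      rw [hgrad, inner_neg_right, inner_smul_right, real_inner_comm]
      ring
    have := is_const_of_deriv_eq_zero (fun s => (hd s).differentiableAt) (fun s => (hd s).deriv) t 0
    simpa [hφ₀] using this
  -- positive energy lower bound on K
  have hpc : Continuous p := by
    have : p = fun w => ‖w.2‖ ^ 2 + V₁ w.1 := funext hp
    rw [this]
    have := hV₁.continuous
    fun_prop
  obtain ⟨c, hc0, hc⟩ := hK.exists_forall_le' hpc.continuousOn (a := 0)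
    (fun w hw => hI (subset_closure (hKsub hw).1))
  -- decay
  obtain ⟨C0, hC00, hC0⟩ := hV₁decay 0
  obtain ⟨C1, hC10, hC1⟩ := hV₁decay 1
  have hdec : ∀ x, 8 * V₁ x + 4 * ⟪x, gradient V₁ x⟫ ≤
      (8 * C0 + 4 * C1) * (1 + ‖x‖ ^ 2) ^ (-(ρ / 2)) := by
    intro x
    have hpos : (0 : ℝ) < 1 + ‖x‖ ^ 2 := by positivity
    have a0 := hC0 x
    rw [norm_iteratedFDeriv_zero] at a0
    have e0 : (-ρ - ((0 : ℕ) : ℝ)) / 2 = -(ρ / 2) := by push_cast; ring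
    rw [e0] at a0
    have a1 := hC1 x
    rw [← hgnorm] at a1
    have e1 : (-ρ - ((1 : ℕ) : ℝ)) / 2 = -(ρ / 2) - 1 / 2 := by push_cast; ring
    rw [e1, Real.rpow_sub hpos, ← Real.sqrt_eq_rpow] at a1
    have hs : ‖x‖ ≤ √(1 + ‖x‖ ^ 2) := Real.le_sqrt_of_sq_le (by linarith)
    have hspos : 0 < √(1 + ‖x‖ ^ 2) := Real.sqrt_pos.2 hpos
    set A := (1 + ‖x‖ ^ 2) ^ (-(ρ / 2)) with hA
    have hApos : 0 < A := Real.rpow_pos_of_pos hpos _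
    have b1 : ⟪x, gradient V₁ x⟫ ≤ C1 * A := by
      calc ⟪x, gradient V₁ x⟫ ≤ ‖x‖ * ‖gradient V₁ x‖ := real_inner_le_norm _ _
        _ ≤ √(1 + ‖x‖ ^ 2) * (C1 * (A / √(1 + ‖x‖ ^ 2))) := by gcongr
        _ = C1 * A := by field_simp
    have b0 : V₁ x ≤ C0 * A := (Real.le_norm_self _).trans a0
    linarith
  obtain ⟨R0, hR0⟩ : ∃ R0 : ℝ, ∀ r, R0 ≤ r → (8 * C0 + 4 * C1) * (1 + r) ^ (-(ρ / 2)) < 8 * c := by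
    have h1 : Tendsto (fun r : ℝ => (8 * C0 + 4 * C1) * (1 + r) ^ (-(ρ / 2))) atTop
        (𝓝 ((8 * C0 + 4 * C1) * 0)) :=
      ((tendsto_rpow_neg_atTop (by positivity)).comp
        (tendsto_atTop_add_const_left _ 1 tendsto_id)).const_mul _
    rw [mul_zero] at h1
    exact eventually_atTop.1 (h1.eventually_lt_const (by positivity))
  obtain ⟨B, hB⟩ := hK.bddAbove_image (f := fun w => ‖w.1‖ ^ 2)
    (by fun_prop : Continuous fun w : EuclideanSpace ℝ (Fin n) × EuclideanSpace ℝ (Fin n) =>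
      ‖w.1‖ ^ 2).continuousOn
  set R := max R0 B with hR
  -- derivatives of the squared distance
  have hf : ∀ w t, HasDerivAt (fun s => ‖(φ s w).1‖ ^ 2) (4 * ⟪(φ t w).1, (φ t w).2⟫) t := by
    intro w t
    refine (hx w t).norm_sq.congr_deriv ?_
    rw [inner_smul_right]
    ring
  have hg : ∀ w t, HasDerivAt (fun s => 4 * ⟪(φ s w).1, (φ s w).2⟫)
      (8 * ‖(φ t w).2‖ ^ 2 - 4 * ⟪(φ t w).1, gradient V₁ (φ t w).1⟫) t := by
    intro w t
    refine (((hx w t).inner ℝ (hξ w t)).const_mul 4).congr_deriv ?_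
    rw [inner_smul_left, inner_neg_right, real_inner_self_eq_norm_sq]
    simp
    ring
  have hstay : ∀ w ∈ K, ∀ t₀, R < ‖(φ t₀ w).1‖ ^ 2 → 0 < 4 * ⟪(φ t₀ w).1, (φ t₀ w).2⟫ →
      ∀ t, t₀ ≤ t → φ t w ∉ K := by
    intro w hw t₀ h1 h2 t ht hmem
    have := barrier_aux _ _ _ R t₀ (hf w) (hg w) (by
      intro s hs
      have e1 := hR0 _ ((le_max_left _ _).trans hs)
      have e2 := hdec (φ s w).1
      have e3 := hen w s
      rw [hp (φ s w)] at e3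
      have e4 := hc w hw
      linarith) h1 h2.le t ht
    have e5 : ‖(φ t w).1‖ ^ 2 ≤ B := hB ⟨_, hmem, rfl⟩
    linarith [le_max_right R0 B]
  -- finite cover
  obtain ⟨T, hT0, hT⟩ : ∃ T : ℝ, 0 ≤ T ∧ ∀ w ∈ K, ∀ t, T ≤ t → φ t w ∉ K := by
    have key : ∃ T : ℝ, 0 ≤ T ∧ ∀ w ∈ K, w ∈ K → ∀ t, T ≤ t → φ t w ∉ K := by
      refine hK.induction_on (p := fun S => ∃ T : ℝ, 0 ≤ T ∧ ∀ w ∈ S, w ∈ K →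
        ∀ t, T ≤ t → φ t w ∉ K) ⟨0, le_rfl, by simp⟩ ?_ ?_ ?_
      · rintro s t hst ⟨T, h0, h⟩
        exact ⟨T, h0, fun w hw => h w (hst hw)⟩
      · rintro s t ⟨T, h0, h⟩ ⟨T', h0', h'⟩
        refine ⟨max T T', h0.trans (le_max_left _ _), ?_⟩
        rintro w (hw | hw) hwK r hr
        · exact h w hw hwK r ((le_max_left _ _).trans hr)
        · exact h' w hw hwK r ((le_max_right _ _).trans hr)
      · intro w hw
        obtain ⟨t₀, h0, h1, h2⟩ := outgoing_aux _ _ R (hf w)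
          ((tendsto_pow_atTop (by norm_num)).comp (hKsub hw).2)
        have hcw := hcontw t₀ h0
        refine ⟨{u | R < ‖(φ t₀ u).1‖ ^ 2 ∧ 0 < 4 * ⟪(φ t₀ u).1, (φ t₀ u).2⟫}, ?_, t₀, h0, ?_⟩
        · apply mem_nhdsWithin_of_mem_nhds
          have o1 : IsOpen {u | R < ‖(φ t₀ u).1‖ ^ 2} :=
            isOpen_lt continuous_const (by fun_prop)
          have o2 : IsOpen {u | 0 < 4 * ⟪(φ t₀ u).1, (φ t₀ u).2⟫} :=
            isOpen_lt continuous_const (by fun_prop)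
          exact (o1.inter o2).mem_nhds ⟨h1, h2⟩
        · intro u hu huK
          exact hstay u huK t₀ hu.1 hu.2
    obtain ⟨T, h0, h⟩ := key
    exact ⟨T, h0, fun w hw => h w hw hw⟩
  refine ⟨T, hT0, fun w => ?_⟩
  have hbdd : BddBelow {t : ℝ | 0 ≤ t ∧ φ t w ∈ K} := ⟨0, fun t ht => ht.1⟩
  refine ⟨sInf {t : ℝ | 0 ≤ t ∧ φ t w ∈ K}, Real.sInf_nonneg fun t ht => ht.1, ?_⟩
  intro t ht htK
  have hmem : t ∈ {t : ℝ | 0 ≤ t ∧ φ t w ∈ K} := ⟨ht, htK⟩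
  refine ⟨csInf_le hbdd hmem, ?_⟩
  have : t - T ≤ sInf {t : ℝ | 0 ≤ t ∧ φ t w ∈ K} := by
    apply le_csInf ⟨t, hmem⟩
    rintro s ⟨_, hsK⟩
    by_contra hcon
    push Not at hcon
    apply hT _ hsK (t - s) (by linarith)
    rw [← hgroup, sub_add_cancel]
    exact htK
  linarith
end

section
/- Let V₂ : ℝⁿ → ℝ be smooth, nonnegative, with bounded derivatives of every order and V₂(x) → 0 as |x| → ∞, and set O = {(x,ξ) : V₂(x) > 0}. Let E > 0 and assume that every bounded trajectory of energy E meets O (for every w with p(w) = E and t ↦ x̄(t,w) bounded, there is t ∈ ℝ with V₂(x̄(t,w)) > 0). Then there exist ε > 0, a constant c₀ > 0 with 2c₀ = min(1, E/2), a constant C_V ≥ 0, and a smooth compactly supported function r : ℝⁿ × ℝⁿ → ℝ such that the Mourre-type symbol estimate {p, b + r}(x,ξ) + C_V V₂(x) ≥ 2c₀ holds for all (x,ξ) with p(x,ξ) ∈ [E − 2ε, E + 2ε], where b(x,ξ) = x·ξ. -/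
open Filter
open scoped RealInnerProductSpace Topology

open MeasureTheory in
theorem aux_smoothing {W : Type*} [NormedAddCommGroup W] [NormedSpace ℝ W]
    [FiniteDimensional ℝ W] [MeasurableSpace W] [BorelSpace W]
    (X : W → W) (L : NNReal) (hX : LipschitzWith L X) (φ : ℝ → W → W)
    (hφ0 : ∀ w, φ 0 w = w) (hφ : ∀ w, HasDerivAt (fun s => φ s w) (X w) 0)
    (G : W → ℝ) (K : NNReal) (hG : LipschitzWith K G) (B : ℝ) (hB : ∀ w, |G w| ≤ B)
    (D : W → ℝ) (hD : ∀ w, HasDerivAt (fun s => G (φ s w)) (D w) 0)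
    (κ : ℝ) (hκ : 0 < κ) :
    ∃ G' : W → ℝ, ContDiff ℝ (⊤ : ℕ∞) G' ∧ (∀ w, |G' w| ≤ B) ∧
      ∀ w m, (∀ v, ‖v - w‖ ≤ κ → m ≤ D v) → m - K * L * κ ≤ fderiv ℝ G' w (X w) := by
  let μ : Measure W := Measure.addHaar
  let f : ContDiffBump (0 : W) := ⟨κ / 2, κ, by positivity, by linarith⟩
  set η : W → ℝ := f.normed μ with hη
  have hηc : Continuous η := f.continuous_normed
  have hηi : Integrable η μ := f.integrable_normed
  have hη0 : ∀ u, 0 ≤ η u := fun u => f.nonneg_normed u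
  have hη1 : ∫ u, η u ∂μ = 1 := f.integral_normed
  have hηs : ∀ u, η u ≠ 0 → ‖u‖ ≤ κ := by
    intro u hu
    have : u ∈ Function.support η := hu
    rw [hη, f.support_normed_eq] at this
    exact (mem_ball_zero_iff.1 this).le
  have hGc : Continuous G := hG.continuous
  have hint : ∀ w, Integrable (fun u => η u * G (w - u)) μ := by
    intro w
    refine (hηi.mul_const B).mono' (by fun_prop) (ae_of_all _ fun u => ?_)
    rw [Real.norm_eq_abs, abs_mul, abs_of_nonneg (hη0 u)]
    exact mul_le_mul_of_nonneg_left (hB _) (hη0 u)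
  refine ⟨fun w => ∫ u, η u * G (w - u) ∂μ, ?_, ?_, ?_⟩
  · have := HasCompactSupport.contDiff_convolution_left (n := ⊤) (ContinuousLinearMap.mul ℝ ℝ)
      (f := η) (g := G) (μ := μ) f.hasCompactSupport_normed f.contDiff_normed
      hGc.locallyIntegrable
    exact this
  · intro w
    calc |∫ u, η u * G (w - u) ∂μ| ≤ ∫ u, |η u * G (w - u)| ∂μ := abs_integral_le_integral_abs
      _ ≤ ∫ u, η u * B ∂μ := by
        refine integral_mono (hint w).abs (hηi.mul_const B) fun u => ?_
        simp only []
        rw [abs_mul, abs_of_nonneg (hη0 u)]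
        exact mul_le_mul_of_nonneg_left (hB _) (hη0 u)
      _ = B := by rw [integral_mul_const, hη1, one_mul]
  · intro w m hm
    have hae : ∀ᵐ u ∂μ, DifferentiableAt ℝ G (w - u) :=
      (Measure.measurePreserving_sub_left μ w).quasiMeasurePreserving.ae hG.ae_differentiableAt
    have hmeas : Measurable (fun u => fderiv ℝ G (w - u)) :=
      (measurable_fderiv ℝ G).comp (measurable_const.sub measurable_id)
    obtain ⟨hI, hder⟩ := hasFDerivAt_integral_of_dominated_loc_of_lip (𝕜 := ℝ) (μ := μ)
      (F := fun w u => η u * G (w - u)) (F' := fun u => η u • fderiv ℝ G (w - u))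
      (x₀ := w) (s := Set.univ) (bound := fun u => η u * K) univ_mem
      (Eventually.of_forall fun x => (hint x).aestronglyMeasurable) (hint w)
      (hηc.aestronglyMeasurable.smul hmeas.aestronglyMeasurable)
      (ae_of_all _ fun u => by
        refine LipschitzOnWith.of_dist_le_mul fun x _ y _ => ?_
        rw [Real.dist_eq, ← mul_sub, abs_mul, abs_of_nonneg (hη0 u)]
        have h1 := hG.dist_le_mul (x - u) (y - u)
        rw [Real.dist_eq, dist_sub_right] at h1
        have h2 : ((Real.nnabs (η u * K) : NNReal) : ℝ) = η u * K := by
          rw [Real.coe_nnabs, abs_of_nonneg (mul_nonneg (hη0 u) K.coe_nonneg)]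
        rw [h2, mul_assoc]
        exact mul_le_mul_of_nonneg_left h1 (hη0 u))
      (hηi.mul_const _)
      (by
        filter_upwards [hae] with u hu
        have h1 : HasFDerivAt (fun x => G (x - u)) (fderiv ℝ G (w - u)) w :=
          (hasFDerivAt_comp_sub u).2 hu.hasFDerivAt
        exact h1.const_mul (η u))
    rw [hder.fderiv, ContinuousLinearMap.integral_apply hI]
    have hlow : ∫ u, η u * (m - K * L * κ) ∂μ = m - K * L * κ := by
      rw [integral_mul_const, hη1, one_mul]
    rw [← hlow]
    refine integral_mono_ae (hηi.mul_const _) (hI.apply_continuousLinearMap (X w)) ?_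
    filter_upwards [hae] with u hu
    simp only [smul_apply, smul_eq_mul]
    by_cases h0 : η u = 0
    · simp [h0]
    refine mul_le_mul_of_nonneg_left ?_ (hη0 u)
    have hu' := hηs u h0
    have hDv : fderiv ℝ G (w - u) (X (w - u)) = D (w - u) := by
      have h1 : HasDerivAt (fun s => G (φ s (w - u))) (fderiv ℝ G (w - u) (X (w - u))) 0 := by
        have h2 : HasFDerivAt G (fderiv ℝ G (w - u)) (φ 0 (w - u)) := by
          rw [hφ0]; exact hu.hasFDerivAt
        exact h2.comp_hasDerivAt (0 : ℝ) (hφ (w - u))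
      exact h1.unique (hD _)
    have h3 : m ≤ D (w - u) := hm _ (by simpa using hu')
    have h4 : |fderiv ℝ G (w - u) (X w - X (w - u))| ≤ K * (L * κ) := by
      calc _ ≤ ‖fderiv ℝ G (w - u)‖ * ‖X w - X (w - u)‖ := ContinuousLinearMap.le_opNorm _ _
        _ ≤ K * (L * κ) := by
          refine mul_le_mul (norm_fderiv_le_of_lipschitz ℝ hG) ?_ (norm_nonneg _) K.2
          have h5 := hX.dist_le_mul w (w - u)
          rw [dist_eq_norm, dist_eq_norm] at h5
          refine h5.trans (mul_le_mul_of_nonneg_left ?_ L.2)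
          simpa using hu'
    rw [map_sub] at h4
    have := (abs_le.1 h4).1
    linarith

theorem aux_flow_group {W : Type*} [NormedAddCommGroup W] [NormedSpace ℝ W]
    (X : W → W) (L : NNReal) (hX : LipschitzWith L X) (φ : ℝ → W → W)
    (hφ0 : ∀ w, φ 0 w = w) (hφ : ∀ w t, HasDerivAt (fun s => φ s w) (X (φ t w)) t)
    (s t : ℝ) (w : W) : φ t (φ s w) = φ (t + s) w := by
  have := ODE_solution_unique_univ (v := fun _ => X) (s := fun _ => Set.univ) (K := L)
    (f := fun t => φ t (φ s w)) (g := fun t => φ (t + s) w) (t₀ := 0)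
    (fun t => hX.lipschitzOnWith) (fun t => ⟨hφ _ t, trivial⟩)
    (fun t => ⟨(hφ w (t + s)).comp_add_const t s, trivial⟩) (by simp [hφ0])
  exact congrFun this t

theorem aux_flow_lip {W : Type*} [NormedAddCommGroup W] [NormedSpace ℝ W]
    (X : W → W) (L : NNReal) (hX : LipschitzWith L X) (φ : ℝ → W → W)
    (hφ0 : ∀ w, φ 0 w = w) (hφ : ∀ w t, HasDerivAt (fun s => φ s w) (X (φ t w)) t)
    (t : ℝ) (ht : 0 ≤ t) (w w' : W) :
    dist (φ t w) (φ t w') ≤ dist w w' * Real.exp (L * t) := by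
  have := dist_le_of_trajectories_ODE (v := fun _ => X) (K := L) (a := 0) (b := t)
    (f := fun t => φ t w) (g := fun t => φ t w') (δ := dist w w') (fun _ => hX)
    (fun t _ => (hφ w t).continuousAt.continuousWithinAt)
    (fun t _ => (hφ w t).hasDerivWithinAt)
    (fun t _ => (hφ w' t).continuousAt.continuousWithinAt)
    (fun t _ => (hφ w' t).hasDerivWithinAt) (by simp [hφ0]) t ⟨ht, le_rfl⟩
  simpa using this

theorem aux_flow_cont {W : Type*} [NormedAddCommGroup W] [NormedSpace ℝ W]
    (X : W → W) (L : NNReal) (hX : LipschitzWith L X) (φ : ℝ → W → W)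
    (hφ0 : ∀ w, φ 0 w = w) (hφ : ∀ w t, HasDerivAt (fun s => φ s w) (X (φ t w)) t)
    (t : ℝ) : Continuous (φ t) := by
  rcases le_total 0 t with ht | ht
  · refine (LipschitzWith.of_dist_le_mul (K := (Real.exp (L * t)).toNNReal) fun w w' => ?_).continuous
    rw [Real.coe_toNNReal _ (Real.exp_pos _).le, mul_comm]
    exact aux_flow_lip X L hX φ hφ0 hφ t ht w w'
  · refine (LipschitzWith.of_dist_le_mul (K := (Real.exp (L * (-t))).toNNReal)
      fun w w' => ?_).continuous
    rw [Real.coe_toNNReal _ (Real.exp_pos _).le, mul_comm]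
    have := aux_flow_lip (fun w => - X w) L
      (LipschitzWith.of_dist_le_mul fun x y => by rw [dist_neg_neg]; exact hX.dist_le_mul x y)
      (fun t => φ (-t)) (by simpa using hφ0)
      (fun w t => by
        have h := (hφ w (-t)).scomp t (hasDerivAt_neg t)
        simpa [Function.comp_def] using h) (-t) (by linarith) w w'
    simpa using this

/-- Real-variable lemma. -/
theorem aux_real (z : ℝ → ℝ) (hz : Continuous z) (J : Set ℝ) (hJ : IsClosed J) (K Wd : ℝ)
    (hK : 0 ≤ K) (hWd : 0 < Wd) (hout : ∀ t, t ∉ J → 0 ≤ z t) (hlow : ∀ t, -K ≤ z t)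
    (hconv : ∀ a s t, a ∈ J → a ≤ s → s ∉ J → s ≤ t → t ∉ J)
    (hwin : ∀ a, (∀ t ∈ Set.Icc a (a + Wd), t ∈ J) → 0 ≤ ∫ t in a..(a + Wd), z t)
    (T : ℝ) (hT : 0 ≤ T) : -(K * Wd) ≤ ∫ t in (0:ℝ)..T, z t := by
  have hi : ∀ a b, IntervalIntegrable z MeasureTheory.volume a b :=
    fun a b => hz.intervalIntegrable a b
  have hlo : ∀ a b, a ≤ b → -(K * (b - a)) ≤ ∫ t in a..b, z t := by
    intro a b hab
    have := intervalIntegral.integral_mono_on (f := fun _ => -K) hab (by simp) (hi a b)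
      (fun t _ => hlow t)
    simp at this
    linarith
  have hno : ∀ a b, a ≤ b → (∀ t, a < t → t < b → t ∉ J) → 0 ≤ ∫ t in a..b, z t := by
    intro a b hab h
    have := intervalIntegral.integral_mono_on_of_le_Ioo (f := fun _ => (0:ℝ)) hab (by simp) (hi a b)
      (fun t ht => hout t (h t ht.1 ht.2))
    simpa using this
  have hA : ∀ N : ℕ, ∀ a ∈ J, ∀ b, a ≤ b → b ≤ a + N * Wd → -(K * Wd) ≤ ∫ t in a..b, z t := by
    intro N
    induction N with
    | zero =>
      intro a _ b hab hb
      have : a = b := by simp at hb; linarith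
      subst this; simp; positivity
    | succ N ih =>
      intro a ha b hab hb
      by_cases hbW : b ≤ a + Wd
      · have := hlo a b hab
        nlinarith
      push Not at hbW
      by_cases hin : ∀ t ∈ Set.Icc a (a + Wd), t ∈ J
      · have h1 := hwin a hin
        have h2 := ih (a + Wd) (hin _ ⟨by linarith, le_rfl⟩) b hbW.le
          (by push_cast at hb; linarith)
        rw [← intervalIntegral.integral_add_adjacent_intervals (hi a (a + Wd)) (hi _ b)]
        linarith
      · push Not at hin
        obtain ⟨s, hs, hsJ⟩ := hin
        have h1 := hlo a s hs.1
        have h2 := hno s b (by linarith [hs.2]) (fun t h _ => hconv a s t ha hs.1 hsJ h.le)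
        rw [← intervalIntegral.integral_add_adjacent_intervals (hi a s) (hi _ b)]
        nlinarith [hs.2]
  by_cases hne : (J ∩ Set.Icc 0 T).Nonempty
  · obtain ⟨a, ⟨haJ, ha⟩, hmin⟩ := (isCompact_Icc.inter_left hJ).exists_isLeast hne
    have h1 := hno 0 a ha.1 (fun t h0 h1 htJ => by
      have := hmin ⟨htJ, h0.le, h1.le.trans ha.2⟩
      linarith)
    obtain ⟨N, hN⟩ := exists_nat_ge ((T - a) / Wd)
    have h2 := hA N a haJ T ha.2 (by rw [div_le_iff₀ hWd] at hN; linarith)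
    rw [← intervalIntegral.integral_add_adjacent_intervals (hi 0 a) (hi _ T)]
    linarith
  · have h1 := hno 0 T hT (fun t h0 h1 htJ => hne ⟨t, htJ, h0.le, h1.le⟩)
    nlinarith

theorem aux_avg {W : Type*} [NormedAddCommGroup W] [NormedSpace ℝ W]
    (X : W → W) (L : NNReal) (hX : LipschitzWith L X) (φ : ℝ → W → W)
    (hφ0 : ∀ w, φ 0 w = w) (hφ : ∀ w t, HasDerivAt (fun s => φ s w) (X (φ t w)) t)
    (h : W → ℝ) (Kh : NNReal) (hh : LipschitzWith Kh h) (B : ℝ) (hB : ∀ w, |h w| ≤ B)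
    (T : ℝ) (hT : 0 < T) :
    ∃ (G : W → ℝ) (K : NNReal) (B' : ℝ), LipschitzWith K G ∧ (∀ w, |G w| ≤ B') ∧
      ∀ w, HasDerivAt (fun s => G (φ s w)) (1 / T * (∫ τ in (0:ℝ)..T, h (φ τ w)) - h w) 0 := by
  have hcont : ∀ w, Continuous (fun t => φ t w) := fun w =>
    continuous_iff_continuousAt.2 fun t => (hφ w t).continuousAt
  have hhc : Continuous h := hh.continuous
  have hyc : ∀ w, Continuous (fun t => h (φ t w)) := fun w => hhc.comp (hcont w)
  have hexp : 0 < Real.exp (L * T) := Real.exp_pos _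
  have hi : ∀ w, IntervalIntegrable (fun τ => (T - τ) * h (φ τ w)) MeasureTheory.volume 0 T := by
    intro w
    exact ((continuous_const.sub continuous_id).mul (hyc w)).intervalIntegrable _ _
  refine ⟨fun w => 1 / T * ∫ τ in (0:ℝ)..T, (T - τ) * h (φ τ w),
    (T * Kh * Real.exp (L * T)).toNNReal, T * B, ?_, ?_, ?_⟩
  · refine LipschitzWith.of_dist_le_mul fun w w' => ?_
    rw [Real.coe_toNNReal _ (by positivity), Real.dist_eq, ← mul_sub,
      ← intervalIntegral.integral_sub (hi w) (hi w'), abs_mul]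
    have h1 : ‖∫ τ in (0:ℝ)..T, ((T - τ) * h (φ τ w) - (T - τ) * h (φ τ w'))‖ ≤
        (T * (Kh * (dist w w' * Real.exp (L * T)))) * |T - 0| := by
      refine intervalIntegral.norm_integral_le_of_norm_le_const fun τ hτ => ?_
      rw [Set.uIoc_of_le hT.le] at hτ
      rw [← mul_sub, norm_mul]
      have ha : ‖T - τ‖ ≤ T := by
        rw [Real.norm_eq_abs, abs_of_nonneg (by linarith [hτ.2])]; linarith [hτ.1]
      have hb : ‖h (φ τ w) - h (φ τ w')‖ ≤ Kh * (dist w w' * Real.exp (L * T)) := by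
        rw [← dist_eq_norm]
        refine (hh.dist_le_mul _ _).trans (mul_le_mul_of_nonneg_left ?_ Kh.2)
        refine (aux_flow_lip X L hX φ hφ0 hφ τ hτ.1.le w w').trans ?_
        refine mul_le_mul_of_nonneg_left (Real.exp_le_exp.2 ?_) dist_nonneg
        exact mul_le_mul_of_nonneg_left hτ.2 L.2
      exact mul_le_mul ha hb (norm_nonneg _) hT.le
    rw [Real.norm_eq_abs] at h1
    rw [abs_of_pos (by positivity : (0:ℝ) < 1 / T)]
    refine (mul_le_mul_of_nonneg_left h1 (by positivity)).trans (le_of_eq ?_)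
    rw [sub_zero, abs_of_pos hT]
    field_simp
  · intro w
    have h1 : ‖∫ τ in (0:ℝ)..T, (T - τ) * h (φ τ w)‖ ≤ (T * B) * |T - 0| := by
      refine intervalIntegral.norm_integral_le_of_norm_le_const fun τ hτ => ?_
      rw [Set.uIoc_of_le hT.le] at hτ
      rw [norm_mul]
      have ha : ‖T - τ‖ ≤ T := by
        rw [Real.norm_eq_abs, abs_of_nonneg (by linarith [hτ.2])]; linarith [hτ.1]
      exact mul_le_mul ha (hB _) (norm_nonneg _) hT.le
    rw [Real.norm_eq_abs] at h1
    rw [abs_mul, abs_of_pos (by positivity : (0:ℝ) < 1 / T)]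
    refine (mul_le_mul_of_nonneg_left h1 (by positivity)).trans (le_of_eq ?_)
    rw [sub_zero, abs_of_pos hT]
    field_simp
  · intro w
    set y : ℝ → ℝ := fun t => h (φ t w) with hy
    have hyc' : Continuous y := hyc w
    let Y : ℝ → ℝ := fun s => ∫ τ in (0:ℝ)..s, y τ
    let Z : ℝ → ℝ := fun s => ∫ τ in (0:ℝ)..s, τ * y τ
    have hY : ∀ s, HasDerivAt Y (y s) s := fun s => hyc'.integral_hasStrictDerivAt 0 s |>.hasDerivAt
    have hZc : Continuous (fun τ => τ * y τ) := continuous_id.mul hyc'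
    have hZ : ∀ s, HasDerivAt Z (s * y s) s := fun s =>
      hZc.integral_hasStrictDerivAt 0 s |>.hasDerivAt
    have key : (fun s => 1 / T * ∫ τ in (0:ℝ)..T, (T - τ) * h (φ τ (φ s w))) =
        fun s => 1 / T * ((T + s) * (Y (T + s) - Y s) - (Z (T + s) - Z s)) := by
      funext s
      congr 1
      have e1 : ∀ τ, (T - τ) * h (φ τ (φ s w)) = (fun u => (T + s - u) * y u) (τ + s) := by
        intro τ
        simp only [hy]
        rw [aux_flow_group X L hX φ hφ0 hφ]
        ring_nf
      simp_rw [e1]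
      rw [intervalIntegral.integral_comp_add_right (fun u => (T + s - u) * y u) s]
      have e2 : Y (T + s) - Y s = ∫ u in s..(T + s), y u :=
        intervalIntegral.integral_interval_sub_left (hyc'.intervalIntegrable _ _)
          (hyc'.intervalIntegrable _ _)
      have e3 : Z (T + s) - Z s = ∫ u in s..(T + s), u * y u :=
        intervalIntegral.integral_interval_sub_left (hZc.intervalIntegrable _ _)
          (hZc.intervalIntegrable _ _)
      have e4 : IntervalIntegrable (fun u => (T + s) * y u) MeasureTheory.volume s (T + s) :=
        (continuous_const.mul hyc').intervalIntegrable _ _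
      rw [e2, e3, ← intervalIntegral.integral_const_mul, ← intervalIntegral.integral_sub
        e4 (hZc.intervalIntegrable _ _), zero_add]
      congr 1
      funext u
      ring
    rw [key]
    have hTs : HasDerivAt (fun s : ℝ => T + s) 1 0 := (hasDerivAt_id (0:ℝ)).const_add T
    have d1 : HasDerivAt (fun s => Y (T + s)) (y (T + 0)) 0 := (hY (T + 0)).comp_const_add T 0
    have d2 : HasDerivAt (fun s => Z (T + s)) ((T + 0) * y (T + 0)) 0 :=
      (hZ (T + 0)).comp_const_add T 0
    have d := ((hTs.mul (d1.sub (hY 0))).sub (d2.sub (hZ 0))).const_mul (1 / T)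
    refine d.congr_deriv ?_
    have y0 : y 0 = h w := by simp [hy, hφ0]
    have Y0 : Y 0 = 0 := by simp [Y]
    simp only [Pi.sub_apply, add_zero, Y0, y0, sub_zero, zero_mul]
    change _ = 1 / T * Y T - h w
    field_simp
    ring

theorem aux_window {H : Type*} [NormedAddCommGroup H] 
    (φ : ℝ → H × H → H × H)
    (hφw : ∀ t, Continuous (φ t)) (hφt : ∀ w, Continuous (fun t => φ t w))
    (p : H × H → ℝ) (hpc : Continuous p) (V₂ : H → ℝ) (hVc : Continuous V₂)
    (hV0 : ∀ x, 0 ≤ V₂ x) (B : ℝ) (hB : ∀ x, V₂ x ≤ B) (E R : ℝ)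
    (hmeet : ∀ w, p w = E → (∃ M : ℝ, ∀ t : ℝ, ‖(φ t w).1‖ ≤ M) →
      ∃ t : ℝ, 0 < V₂ (φ t w).1)
    (S : Set (H × H)) (hS : IsCompact S) (hSmem : ∀ w, ‖w.1‖ ≤ R → p w ≤ E + 1 → w ∈ S)
    (hφ0 : ∀ w, φ 0 w = w) :
    ∃ T₁ : ℝ, 0 < T₁ ∧ ∃ δ : ℝ, 0 < δ ∧ ∃ ε : ℝ, 0 < ε ∧ ∀ w, |p w - E| ≤ ε →
      (∀ t ∈ Set.Icc (-T₁) T₁, ‖(φ t w).1‖ ≤ R) →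
      δ ≤ ∫ t in (-T₁)..T₁, V₂ (φ t w).1 := by
  by_contra hcon
  push Not at hcon
  have hpos : ∀ k : ℕ, (0:ℝ) < (k:ℝ) + 1 := fun k => by positivity
  have hstep : ∀ k : ℕ, ∃ w, |p w - E| ≤ 1 / ((k:ℝ) + 1) ∧
      (∀ t ∈ Set.Icc (-((k:ℝ) + 1)) ((k:ℝ) + 1), ‖(φ t w).1‖ ≤ R) ∧
      ∫ t in (-((k:ℝ) + 1))..((k:ℝ) + 1), V₂ (φ t w).1 < 1 / ((k:ℝ) + 1) := fun k =>
    hcon _ (hpos k) _ (one_div_pos.2 (hpos k)) _ (one_div_pos.2 (hpos k))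
  choose u hu1 hu2 hu3 using hstep
  have huS : ∀ k, u k ∈ S := by
    intro k
    refine hSmem _ ?_ ?_
    · have := hu2 k 0 ⟨by linarith [hpos k], (hpos k).le⟩
      rwa [hφ0] at this
    · have h1 := (abs_le.1 (hu1 k)).2
      have h2 : 1 / ((k:ℝ) + 1) ≤ 1 := by
        rw [div_le_one (hpos k)]; linarith [Nat.cast_nonneg (α := ℝ) k]
      linarith
  obtain ⟨w, -, g, hg, hlim⟩ := hS.tendsto_subseq huS
  have hone : Tendsto (fun k : ℕ => 1 / ((g k : ℝ) + 1)) atTop (𝓝 0) :=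
    tendsto_one_div_add_atTop_nhds_zero_nat.comp hg.tendsto_atTop
  have hpw : p w = E := by
    have h1 : Tendsto (fun k => |p (u (g k)) - E|) atTop (𝓝 |p w - E|) :=
      (((hpc.tendsto w).comp hlim).sub_const E).abs
    have h2 := le_of_tendsto_of_tendsto' h1 hone (fun k => hu1 (g k))
    have h3 := abs_nonpos_iff.1 h2
    linarith
  have hgk : ∀ T : ℝ, ∀ᶠ k in atTop, T ≤ (g k : ℝ) + 1 := by
    intro T
    have : Tendsto (fun k => ((g k : ℕ) : ℝ)) atTop atTop :=
      tendsto_natCast_atTop_atTop.comp hg.tendsto_atTop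
    filter_upwards [this.eventually_ge_atTop T] with k hk
    linarith
  have hbd : ∀ t, ‖(φ t w).1‖ ≤ R := by
    intro t
    have h1 : Tendsto (fun k => ‖(φ t (u (g k))).1‖) atTop (𝓝 ‖(φ t w).1‖) :=
      ((continuous_norm.comp (continuous_fst.comp (hφw t))).tendsto w).comp hlim
    refine le_of_tendsto h1 ?_
    filter_upwards [hgk |t|] with k hk
    exact hu2 _ t (abs_le.1 hk)
  obtain ⟨t₀, ht₀⟩ := hmeet w hpw ⟨R, hbd⟩
  set T : ℝ := |t₀| + 1 with hT
  have hTpos : 0 < T := by positivity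
  have hc : ∀ w, Continuous (fun t => V₂ (φ t w).1) := fun w =>
    hVc.comp (continuous_fst.comp (hφt w))
  have hI : Tendsto (fun k => ∫ t in (-T)..T, V₂ (φ t (u (g k))).1) atTop
      (𝓝 (∫ t in (-T)..T, V₂ (φ t w).1)) := by
    refine intervalIntegral.tendsto_integral_filter_of_dominated_convergence (fun _ => B)
      (Eventually.of_forall fun k => (hc _).aestronglyMeasurable)
      (Eventually.of_forall fun k => MeasureTheory.ae_of_all _ fun t _ => ?_)
      (by simp) (MeasureTheory.ae_of_all _ fun t _ => ?_)
    · rw [Real.norm_eq_abs, abs_of_nonneg (hV0 _)]; exact hB _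
    · exact ((hVc.comp (continuous_fst.comp (hφw t))).tendsto w).comp hlim
  have hIle : ∫ t in (-T)..T, V₂ (φ t w).1 ≤ 0 := by
    refine le_of_tendsto_of_tendsto hI hone ?_
    filter_upwards [hgk T] with k hk
    refine le_trans ?_ (hu3 (g k)).le
    refine intervalIntegral.integral_mono_interval (by linarith) (by linarith) hk
      (Eventually.of_forall fun t => hV0 _) ((hc _).intervalIntegrable _ _)
  have hIpos : 0 < ∫ t in (-T)..T, V₂ (φ t w).1 := by
    refine intervalIntegral.integral_pos (by linarith) (hc w).continuousOn (fun t _ => hV0 _)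
      ⟨t₀, abs_le.1 (by linarith), ht₀⟩
  linarith

/-- Convexity of the squared distance outside a ball. -/
theorem aux_convex {H : Type*} [NormedAddCommGroup H] [InnerProductSpace ℝ H]
    (x ξ : ℝ → H) (f : ℝ → ℝ) (hx : ∀ t, HasDerivAt x ((2:ℝ) • ξ t) t)
    (hb : ∀ t, HasDerivAt (fun t => ⟪x t, ξ t⟫) (f t) t) (R : ℝ)
    (hf : ∀ t, R < ‖x t‖ → 0 < f t) (a s t : ℝ) (ha : ‖x a‖ ≤ R) (has : a ≤ s)
    (hs : R < ‖x s‖) (hst : s ≤ t) : R < ‖x t‖ := by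
  by_contra hcon
  push Not at hcon
  have hR : 0 ≤ R := (norm_nonneg _).trans ha
  set q : ℝ → ℝ := fun t => ‖x t‖ ^ 2 with hq
  have hqd : ∀ t, HasDerivAt q (4 * ⟪x t, ξ t⟫) t := by
    intro t
    refine ((hx t).norm_sq).congr_deriv ?_
    rw [inner_smul_right]; ring
  have hqc : Continuous q := continuous_iff_continuousAt.2 fun t => (hqd t).continuousAt
  obtain ⟨s₀, hs₀, hmax⟩ := isCompact_Icc.exists_isMaxOn (s := Set.Icc a t)
    ⟨s, has, hst⟩ hqc.continuousOn
  have hqs : q s ≤ q s₀ := hmax ⟨has, hst⟩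
  have hRs : R ^ 2 < q s := by simp only [hq]; gcongr
  have hRs₀ : R < ‖x s₀‖ := lt_of_pow_lt_pow_left₀ 2 (norm_nonneg _) (hRs.trans_le hqs)
  have h1 : a < s₀ := lt_of_le_of_ne hs₀.1 (by rintro rfl; linarith)
  have h2 : s₀ < t := lt_of_le_of_ne hs₀.2 (by rintro rfl; linarith)
  have hlmax : IsLocalMax q s₀ := hmax.isLocalMax (Icc_mem_nhds h1 h2)
  have hder : deriv q = fun t => 4 * ⟪x t, ξ t⟫ := funext fun t => (hqd t).deriv
  have hder2 : deriv (deriv q) s₀ = 4 * f s₀ := by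
    rw [hder]; exact ((hb s₀).const_mul 4).deriv
  have hpos : 0 < deriv (deriv q) s₀ := by rw [hder2]; linarith [hf s₀ hRs₀]
  have hlmin : IsLocalMin q s₀ :=
    isLocalMin_of_deriv_deriv_pos hpos hlmax.deriv_eq_zero hqc.continuousAt
  have hconst : q =ᶠ[𝓝 s₀] fun _ => q s₀ := by
    filter_upwards [hlmax, hlmin] with r h1 h2
    exact le_antisymm h1 h2
  have := hconst.deriv.deriv_eq
  simp at this
  linarith

theorem aux_lip_of_iter {H : Type*} [NormedAddCommGroup H] [NormedSpace ℝ H]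
    (V : H → ℝ) (hV : ContDiff ℝ (⊤ : ℕ∞) V) (C : ℝ)
    (h : ∀ x, ‖iteratedFDeriv ℝ 1 V x‖ ≤ C) : LipschitzWith C.toNNReal V := by
  refine lipschitzWith_of_nnnorm_fderiv_le (𝕜 := ℝ) (hV.differentiable (by simp)) fun x => ?_
  rw [← NNReal.coe_le_coe]
  have := h x
  rw [norm_iteratedFDeriv_one] at this
  exact this.trans (Real.le_coe_toNNReal C)

theorem aux_grad_lip {H : Type*} [NormedAddCommGroup H] [InnerProductSpace ℝ H] [CompleteSpace H]
    (V : H → ℝ) (hV : ContDiff ℝ (⊤ : ℕ∞) V) (C : ℝ)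
    (h : ∀ x, ‖iteratedFDeriv ℝ 2 V x‖ ≤ C) : LipschitzWith C.toNNReal (gradient V) := by
  have hd : ContDiff ℝ (⊤ : ℕ∞) (fderiv ℝ V) := hV.fderiv_right (by simp)
  have h1 : LipschitzWith C.toNNReal (fderiv ℝ V) := by
    refine lipschitzWith_of_nnnorm_fderiv_le (𝕜 := ℝ) (hd.differentiable (by simp)) fun x => ?_
    rw [← NNReal.coe_le_coe]
    have := h x
    rw [← norm_iteratedFDeriv_fderiv, norm_iteratedFDeriv_one] at this
    exact this.trans (Real.le_coe_toNNReal C)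
  have h2 := (InnerProductSpace.toDual ℝ H).symm.lipschitz.comp h1
  rw [one_mul] at h2
  exact h2

theorem aux_decay {H : Type*} [NormedAddCommGroup H] [InnerProductSpace ℝ H] [CompleteSpace H]
    (ρ : ℝ) (hρ : 0 < ρ) (V₁ : H → ℝ)
    (hV₁decay : ∀ k : ℕ, ∃ C : ℝ, 0 ≤ C ∧ ∀ x,
      ‖iteratedFDeriv ℝ k V₁ x‖ ≤ C * (1 + ‖x‖ ^ 2) ^ ((-ρ - (k : ℝ)) / 2))
    (E : ℝ) (hE : 0 < E) :
    ∃ A : ℝ, 0 ≤ A ∧ (∀ x, |V₁ x| ≤ A) ∧ (∀ x, ‖gradient V₁ x‖ ≤ A) ∧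
      (∀ x, |2 * V₁ x + ⟪x, gradient V₁ x⟫| ≤ A) ∧
      ∃ R : ℝ, 0 < R ∧ ∀ x, R ≤ ‖x‖ → 2 * V₁ x + ⟪x, gradient V₁ x⟫ ≤ E := by
  obtain ⟨C₀, hC₀, h0⟩ := hV₁decay 0
  obtain ⟨C₁, hC₁, h1⟩ := hV₁decay 1
  let j : H → ℝ := fun x => (1 + ‖x‖ ^ 2) ^ (-(ρ / 2))
  have hb1 : ∀ x : H, 1 ≤ 1 + ‖x‖ ^ 2 := fun x => by nlinarith [sq_nonneg ‖x‖]
  have hj0 : ∀ x, 0 ≤ j x := fun x => Real.rpow_nonneg (by linarith [hb1 x]) _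
  have hj1 : ∀ x, j x ≤ 1 := fun x =>
    Real.rpow_le_one_of_one_le_of_nonpos (hb1 x) (by linarith)
  have hV : ∀ x, |V₁ x| ≤ C₀ * j x := by
    intro x
    have := h0 x
    rw [norm_iteratedFDeriv_zero] at this
    convert this using 3
    simp; ring
  have hgn : ∀ x, ‖gradient V₁ x‖ = ‖fderiv ℝ V₁ x‖ := fun x =>
    (InnerProductSpace.toDual ℝ H).symm.norm_map _
  have hg : ∀ x, ‖gradient V₁ x‖ ≤ C₁ * (j x * (1 + ‖x‖ ^ 2) ^ (-(1 / 2) : ℝ)) := by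
    intro x
    have := h1 x
    rw [norm_iteratedFDeriv_one] at this
    rw [hgn]
    refine this.trans (le_of_eq ?_)
    simp only [j]
    rw [← Real.rpow_add (by linarith [hb1 x])]
    congr 2
    push_cast; ring
  have hs1 : ∀ x : H, (1 + ‖x‖ ^ 2) ^ (-(1 / 2) : ℝ) ≤ 1 := fun x =>
    Real.rpow_le_one_of_one_le_of_nonpos (hb1 x) (by norm_num)
  have hs2 : ∀ x : H, ‖x‖ * (1 + ‖x‖ ^ 2) ^ (-(1 / 2) : ℝ) ≤ 1 := by
    intro x
    have hp : 0 < 1 + ‖x‖ ^ 2 := by linarith [hb1 x]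
    rw [Real.rpow_neg hp.le, ← Real.sqrt_eq_rpow, ← div_eq_mul_inv,
      div_le_one (Real.sqrt_pos.2 hp)]
    exact Real.le_sqrt_of_sq_le (by linarith)
  have hP : ∀ x, |2 * V₁ x + ⟪x, gradient V₁ x⟫| ≤ (2 * C₀ + C₁) * j x := by
    intro x
    have a1 := hV x
    have a2 : |⟪x, gradient V₁ x⟫| ≤ C₁ * j x := by
      calc _ ≤ ‖x‖ * ‖gradient V₁ x‖ := abs_real_inner_le_norm _ _
        _ ≤ ‖x‖ * (C₁ * (j x * (1 + ‖x‖ ^ 2) ^ (-(1 / 2) : ℝ))) :=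
          mul_le_mul_of_nonneg_left (hg x) (norm_nonneg _)
        _ = (C₁ * j x) * (‖x‖ * (1 + ‖x‖ ^ 2) ^ (-(1 / 2) : ℝ)) := by ring
        _ ≤ (C₁ * j x) * 1 :=
          mul_le_mul_of_nonneg_left (hs2 x) (mul_nonneg hC₁ (hj0 x))
        _ = _ := mul_one _
    calc _ ≤ |2 * V₁ x| + |⟪x, gradient V₁ x⟫| := abs_add_le _ _
      _ ≤ 2 * (C₀ * j x) + C₁ * j x := by
        rw [abs_mul, abs_of_pos (by norm_num : (0:ℝ) < 2)]; linarith
      _ = _ := by ring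
  refine ⟨2 * C₀ + C₁, by positivity, fun x => ?_, fun x => ?_, fun x => ?_, ?_⟩
  · have := mul_le_mul_of_nonneg_left (hj1 x) hC₀
    linarith [hV x]
  · have h2 : j x * (1 + ‖x‖ ^ 2) ^ (-(1 / 2) : ℝ) ≤ 1 :=
      mul_le_one₀ (hj1 x) (Real.rpow_nonneg (by linarith [hb1 x]) _) (hs1 x)
    have := mul_le_mul_of_nonneg_left h2 hC₁
    linarith [hg x]
  · have := mul_le_mul_of_nonneg_left (hj1 x) (by positivity : 0 ≤ 2 * C₀ + C₁)
    linarith [hP x]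
  · have t1 : Tendsto (fun y : ℝ => 1 + y ^ 2) atTop atTop :=
      tendsto_atTop_add_const_left _ _ (tendsto_pow_atTop (by norm_num))
    have t2 : Tendsto (fun y : ℝ => (2 * C₀ + C₁) * (1 + y ^ 2) ^ (-(ρ / 2))) atTop (𝓝 0) := by
      have := ((tendsto_rpow_neg_atTop (by positivity : 0 < ρ / 2)).comp t1).const_mul (2 * C₀ + C₁)
      simpa using this
    obtain ⟨R, hR⟩ := eventually_atTop.1 (t2.eventually_le_const hE)
    refine ⟨max R 1, by positivity, fun x hx => ?_⟩
    exact (le_abs_self _).trans ((hP x).trans (hR _ ((le_max_left _ _).trans hx)))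

set_option maxHeartbeats 4000000 in
theorem aux_core {H : Type} [NormedAddCommGroup H] [InnerProductSpace ℝ H] [CompleteSpace H]
    [FiniteDimensional ℝ H] (V₁ V₂ : H → ℝ)
    (hV₁ : ContDiff ℝ (⊤ : ℕ∞) V₁)
    (p : H × H → ℝ)
    (hp : ∀ w, p w = ‖w.2‖ ^ 2 + V₁ w.1)
    (φ : ℝ → H × H →
      H × H)
    (hφ₀ : ∀ w, φ 0 w = w)
    (hflow : ∀ w t, HasDerivAt (fun s => φ s w)
      ((2 : ℝ) • (φ t w).2, -gradient V₁ (φ t w).1) t)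
    (L₀ : NNReal) (hL₀ : LipschitzWith L₀ (gradient V₁))
    (hV0 : ∀ x, 0 ≤ V₂ x) (L₂ : NNReal) (hL₂ : LipschitzWith L₂ V₂)
    (B₂ : ℝ) (hB₂ : ∀ x, V₂ x ≤ B₂) (E : ℝ) (hE : 0 < E)
    (hmeet : ∀ w, p w = E → (∃ M : ℝ, ∀ t : ℝ, ‖(φ t w).1‖ ≤ M) →
      ∃ t : ℝ, 0 < V₂ (φ t w).1)
    (A : ℝ) (hA : 0 ≤ A) (hA0 : ∀ x, |V₁ x| ≤ A) (hA1 : ∀ x, ‖gradient V₁ x‖ ≤ A)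
    (hA2 : ∀ x, |2 * V₁ x + ⟪x, gradient V₁ x⟫| ≤ A)
    (R : ℝ) (hR : 0 < R) (hPR : ∀ x, R ≤ ‖x‖ → 2 * V₁ x + ⟪x, gradient V₁ x⟫ ≤ E) :
    ∃ ε : ℝ, 0 < ε ∧ ∃ C : ℝ, 0 ≤ C ∧
      ∃ r : H × H → ℝ,
        ContDiff ℝ (⊤ : ℕ∞) r ∧ HasCompactSupport r ∧
        ∀ w, |p w - E| ≤ 2 * ε →
          E / 2 ≤ 2 * ‖w.2‖ ^ 2 - ⟪w.1, gradient V₁ w.1⟫ +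
            fderiv ℝ r w ((2:ℝ) • w.2, -gradient V₁ w.1) + C * V₂ w.1 := by
  let X : H × H → H × H := fun w => ((2 : ℝ) • w.2, -gradient V₁ w.1)
  obtain ⟨L, hX⟩ : ∃ L : NNReal, LipschitzWith L X := by
    have e1 : LipschitzWith (2 * 1) (fun w : H × H => (2:ℝ) • w.2) := by
      refine LipschitzWith.comp (g := fun w : H × H => w.2) (f := fun v : H => (2:ℝ) • v) ?_
        LipschitzWith.prod_snd
      have := lipschitzWith_smul (α := ℝ) (β := H) (2:ℝ)
      simpa using this
    have e2 : LipschitzWith (L₀ * 1) (fun w : H × H => -gradient V₁ w.1) :=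
      (hL₀.comp LipschitzWith.prod_fst).neg
    exact ⟨_, e1.prodMk e2⟩
  have hφ : ∀ w t, HasDerivAt (fun s => φ s w) (X (φ t w)) t := hflow
  have hgroup := aux_flow_group X L hX φ hφ₀ hφ
  have hφw := aux_flow_cont X L hX φ hφ₀ hφ
  have hφt : ∀ w, Continuous (fun t => φ t w) := fun w =>
    continuous_iff_continuousAt.2 fun t => (hφ w t).continuousAt
  have hVd : ∀ x, HasGradientAt V₁ (gradient V₁ x) x := fun x =>
    ((hV₁.differentiable (by simp)) x).hasGradientAt
  have hx' : ∀ w t, HasDerivAt (fun s => (φ s w).1) ((2:ℝ) • (φ t w).2) t := fun w t => by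
    have hh := ((ContinuousLinearMap.fst ℝ H H).hasFDerivAt (x := φ t w)).comp_hasDerivAt t (hφ w t)
    exact hh
  have hξ' : ∀ w t, HasDerivAt (fun s => (φ s w).2) (-gradient V₁ (φ t w).1) t := fun w t => by
    have hh := ((ContinuousLinearMap.snd ℝ H H).hasFDerivAt (x := φ t w)).comp_hasDerivAt t (hφ w t)
    exact hh
  have hpc : Continuous p := by
    have : p = fun w => ‖w.2‖ ^ 2 + V₁ w.1 := funext hp
    rw [this]
    have := hV₁.continuous
    fun_prop
  -- energy conservation
  have hcons : ∀ w t, p (φ t w) = p w := by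
    intro w t
    have hd : ∀ t, HasDerivAt (fun s => p (φ s w)) 0 t := by
      intro t
      have e1 := (hξ' w t).norm_sq
      have e2 := (hVd (φ t w).1).hasFDerivAt.comp_hasDerivAt t (hx' w t)
      have e3 := e1.add e2
      have : (fun s => p (φ s w)) = fun s => ‖(φ s w).2‖ ^ 2 + V₁ (φ s w).1 :=
        funext fun s => hp _
      rw [this]
      refine e3.congr_deriv ?_
      simp [inner_smul_right, real_inner_comm]
    have := is_const_of_deriv_eq_zero (fun t => (hd t).differentiableAt) (fun t => (hd t).deriv) t 0
    simpa [hφ₀] using this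
  have hb' : ∀ w t, HasDerivAt (fun s => ⟪(φ s w).1, (φ s w).2⟫)
      (2 * ‖(φ t w).2‖ ^ 2 - ⟪(φ t w).1, gradient V₁ (φ t w).1⟫) t := by
    intro w t
    refine ((hx' w t).inner ℝ (hξ' w t)).congr_deriv ?_
    rw [inner_neg_right, inner_smul_left, real_inner_self_eq_norm_sq]
    simp; ring
  -- the bound for the momentum
  set Q : ℝ := 2 * E + A + 1 with hQ
  have hQpos : 0 < Q := by positivity
  -- windows
  obtain ⟨T₁, hT₁, δ, hδ, εw, hεw, hwin⟩ := aux_window φ hφw hφt p hpc V₂ hL₂.continuous hV0 B₂ hB₂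
    E (2 * R) hmeet (Metric.closedBall 0 (2 * R) ×ˢ Metric.closedBall 0 (Q + 1))
    ((isCompact_closedBall _ _).prod (isCompact_closedBall _ _))
    (by
      intro w h1 h2
      refine ⟨by simpa using h1, ?_⟩
      rw [mem_closedBall_zero_iff]
      rw [hp] at h2
      have := (abs_le.1 (hA0 w.1)).1
      have h3 : ‖w.2‖ ^ 2 ≤ (Q + 1) ^ 2 := by nlinarith
      exact le_of_sq_le_sq h3 (by positivity))
    hφ₀
  set K : ℝ := A + E with hK
  have hKpos : 0 < K := by positivity
  set C : ℝ := 2 * T₁ * K / δ with hC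
  have hCpos : 0 < C := by positivity
  have hCδ : C * δ = 2 * T₁ * K := by rw [hC]; field_simp
  -- the function h
  let ψ : ContDiffBump (0 : H) := ⟨R, 2 * R, hR, by linarith⟩
  let h : H → ℝ := fun x => E - K * ψ x + C * V₂ x
  have hψ1 : ∀ x, ψ x ≤ 1 := fun x => ψ.le_one
  have hψ0 : ∀ x, 0 ≤ ψ x := fun x => ψ.nonneg
  have hlow : ∀ x, -K + C * V₂ x ≤ h x - E := by
    intro x; simp only [h]
    nlinarith [hψ1 x]
  have hout : ∀ x, 2 * R ≤ ‖x‖ → E ≤ h x := by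
    intro x hx
    have : ψ x = 0 := ψ.zero_of_le_dist (by simpa using hx)
    simp only [h, this]
    nlinarith [hV0 x]
  have hup : ∀ x, h x ≤ 2 * E - (2 * V₁ x + ⟪x, gradient V₁ x⟫) + C * V₂ x := by
    intro x
    rcases le_total ‖x‖ R with hx | hx
    · have : ψ x = 1 := ψ.one_of_mem_closedBall (by simpa using hx)
      simp only [h, this]
      have := (abs_le.1 (hA2 x)).2
      linarith
    · have := hPR x hx
      simp only [h]
      nlinarith [hψ0 x]
  obtain ⟨Kh, hKh⟩ : ∃ Kh : NNReal, LipschitzWith Kh (fun w : H × H => h w.1) := by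
    obtain ⟨Kψ, hKψ⟩ : ∃ Kψ : NNReal, LipschitzWith Kψ ψ :=
      ⟨_, (ContDiff.lipschitzWith_of_hasCompactSupport ψ.hasCompactSupport
        (ψ.contDiff (n := 1)) (by simp)).choose_spec⟩
    refine ⟨(K * Kψ + C * L₂).toNNReal, LipschitzWith.of_dist_le_mul fun v w => ?_⟩
    rw [Real.coe_toNNReal _ (by positivity), Real.dist_eq]
    have e1 := hKψ.dist_le_mul v.1 w.1
    have e2 := hL₂.dist_le_mul v.1 w.1
    have e3 : dist v.1 w.1 ≤ dist v w := le_max_left _ _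
    rw [Real.dist_eq] at e1 e2
    have : h v.1 - h w.1 = C * (V₂ v.1 - V₂ w.1) - K * (ψ v.1 - ψ w.1) := by simp only [h]; ring
    rw [this]
    calc _ ≤ |C * (V₂ v.1 - V₂ w.1)| + |K * (ψ v.1 - ψ w.1)| := abs_sub _ _
      _ = C * |V₂ v.1 - V₂ w.1| + K * |ψ v.1 - ψ w.1| := by
        rw [abs_mul, abs_mul, abs_of_pos hCpos, abs_of_pos hKpos]
      _ ≤ C * (L₂ * dist v.1 w.1) + K * (Kψ * dist v.1 w.1) := by gcongr
      _ ≤ C * (L₂ * dist v w) + K * (Kψ * dist v w) := by gcongr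
      _ = _ := by ring
  have hhb : ∀ w : H × H, |h w.1| ≤ E + K + C * B₂ := by
    intro w
    have h1 := hV0 w.1
    have h2 := hB₂ w.1
    have h3 := mul_le_mul_of_nonneg_left h2 hCpos.le
    have h4 := mul_nonneg hCpos.le h1
    have h5 := mul_nonneg hKpos.le (hψ0 w.1)
    have h6 := mul_le_mul_of_nonneg_left (hψ1 w.1) hKpos.le
    rw [abs_le]
    simp only [h]
    constructor <;> linarith
  set ε₁ : ℝ := min εw (E / 16) with hε₁
  have hε₁pos : 0 < ε₁ := by positivity
  have hε₁w : ε₁ ≤ εw := min_le_left _ _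
  have hε₁E : ε₁ ≤ E / 16 := min_le_right _ _
  have hcontz : ∀ w, Continuous (fun t => h (φ t w).1) := fun w => hKh.continuous.comp (hφt w)
  have hcontV : ∀ w, Continuous (fun t => V₂ (φ t w).1) := fun w =>
    hL₂.continuous.comp (continuous_fst.comp (hφt w))
  -- the averaged estimate
  set T : ℝ := 8 * (K * (2 * T₁)) / E with hT
  have hTpos : 0 < T := by positivity
  have havg : ∀ w, |p w - E| ≤ ε₁ → 7 * E / 8 ≤ 1 / T * ∫ τ in (0:ℝ)..T, h (φ τ w).1 := by
    intro w hw
    have hmain := aux_real (fun t => h (φ t w).1 - E) ((hcontz w).sub continuous_const)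
      {t | ‖(φ t w).1‖ ≤ 2 * R}
      (isClosed_le (continuous_norm.comp (continuous_fst.comp (hφt w))) continuous_const)
      K (2 * T₁) hKpos.le (by positivity)
      (fun t ht => by
        have ht' : 2 * R < ‖(φ t w).1‖ := by simpa using ht
        linarith [hout _ ht'.le])
      (fun t => by
        have := hlow (φ t w).1
        have h1 := mul_nonneg hCpos.le (hV0 (φ t w).1)
        linarith)
      (by
        intro a s t ha has hs hst
        have hs' : 2 * R < ‖(φ s w).1‖ := by simpa using hs
        have := aux_convex (fun t => (φ t w).1) (fun t => (φ t w).2) _ (hx' w) (hb' w) (2 * R)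
          (by
            intro t ht
            have e1 := hPR (φ t w).1 (by linarith)
            have e2 := hcons w t
            rw [hp (φ t w)] at e2
            have e3 := (abs_le.1 hw).1
            linarith) a s t ha has hs' hst
        simpa using this)
      (by
        intro a ha
        have e1 := hwin (φ (a + T₁) w) (by rw [hcons]; exact hw.trans hε₁w)
          (by
            intro t ht
            rw [hgroup]
            exact ha _ ⟨by linarith [ht.1], by linarith [ht.2]⟩)
        simp_rw [hgroup] at e1
        rw [intervalIntegral.integral_comp_add_right (fun t => V₂ (φ t w).1) (a + T₁)] at e1
        have e2 : -T₁ + (a + T₁) = a := by ring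
        have e3 : T₁ + (a + T₁) = a + 2 * T₁ := by ring
        rw [e2, e3] at e1
        have e4 : ∫ t in a..(a + 2 * T₁), (-K + C * V₂ (φ t w).1) ≤
            ∫ t in a..(a + 2 * T₁), (h (φ t w).1 - E) := by
          refine intervalIntegral.integral_mono_on (by linarith) ?_ ?_ (fun t _ => hlow _)
          · exact (continuous_const.add (continuous_const.mul (hcontV w))).intervalIntegrable _ _
          · exact ((hcontz w).sub continuous_const).intervalIntegrable _ _
        have e5 : IntervalIntegrable (fun t => C * V₂ (φ t w).1) MeasureTheory.volume
            a (a + 2 * T₁) := (continuous_const.mul (hcontV w)).intervalIntegrable _ _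
        rw [intervalIntegral.integral_add (by simp) e5, intervalIntegral.integral_const_mul,
          intervalIntegral.integral_const] at e4
        have e6 := mul_le_mul_of_nonneg_left e1 hCpos.le
        rw [hCδ] at e6
        simp only [smul_eq_mul] at e4
        linarith)
      T hTpos.le
    rw [intervalIntegral.integral_sub ((hcontz w).intervalIntegrable _ _) (by simp),
      intervalIntegral.integral_const] at hmain
    simp only [smul_eq_mul] at hmain
    have hTE : K * (2 * T₁) = T * E / 8 := by rw [hT]; field_simp
    rw [hTE] at hmain
    rw [one_div, inv_mul_eq_div, le_div_iff₀ hTpos]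
    linarith
  obtain ⟨G, KG, B', hGlip, hGb, hGd⟩ := aux_avg X L hX φ hφ₀ hφ (fun w => h w.1) Kh hKh _ hhb T hTpos
  have hB'0 : 0 ≤ B' := (abs_nonneg _).trans (hGb 0)
  -- the mollification scale
  obtain ⟨κ, hκ, hκ1, hκ2, hκ3, hκ4⟩ : ∃ κ : ℝ, 0 < κ ∧ κ ≤ 1 ∧ KG * L * κ ≤ E / 32 ∧
      Kh * κ ≤ E / 32 ∧ (2 * Q + 1 + A) * κ ≤ ε₁ / 2 := by
    have key : ∀ a b : ℝ, 0 ≤ a → 0 < b → ∀ᶠ κ in 𝓝[>] (0:ℝ), a * κ ≤ b := by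
      intro a b ha hb
      have : Tendsto (fun κ : ℝ => a * κ) (𝓝[>] 0) (𝓝 0) := by
        have h1 : Tendsto (fun κ : ℝ => a * κ) (𝓝 0) (𝓝 (a * 0)) :=
          (continuous_const.mul continuous_id).tendsto 0
        rw [mul_zero] at h1
        exact h1.mono_left nhdsWithin_le_nhds
      exact this.eventually_le_const hb
    have h0 : ∀ᶠ κ in 𝓝[>] (0:ℝ), 0 < κ := self_mem_nhdsWithin
    obtain ⟨κ, q0, q1, q2, q3, q4⟩ := (h0.and ((key 1 1 (by norm_num) (by norm_num)).and
      ((key (KG * L) (E / 32) (by positivity) (by positivity)).and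
      ((key Kh (E / 32) (by positivity) (by positivity)).and
      (key (2 * Q + 1 + A) (ε₁ / 2) (by positivity) (by positivity)))))).exists
    exact ⟨κ, q0, by linarith, q2, q3, q4⟩
  borelize H
  obtain ⟨G', hG's, hG'b, hG'd⟩ := aux_smoothing X L hX φ hφ₀
    (fun w => by simpa [hφ₀] using hφ w 0) G KG hGlip B' hGb _ hGd κ hκ
  have hξQ : ∀ w, |p w - E| ≤ ε₁ → ‖w.2‖ ≤ Q := by
    intro w hw
    have e1 := (abs_le.1 hw).2
    rw [hp] at e1
    have e2 := (abs_le.1 (hA0 w.1)).1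
    exact le_of_sq_le_sq (by nlinarith) hQpos.le
  have hV₁lip : ∀ x y, |V₁ x - V₁ y| ≤ A * ‖x - y‖ := by
    intro x y
    have := Convex.norm_image_sub_le_of_norm_fderiv_le (𝕜 := ℝ) (f := V₁) (s := Set.univ) (C := A)
      (x := y) (y := x) (fun z _ => (hV₁.differentiable (by simp)) z)
      (fun z _ => by
        have e : ‖gradient V₁ z‖ = ‖fderiv ℝ V₁ z‖ :=
          (InnerProductSpace.toDual ℝ H).symm.norm_map _
        rw [← e]; exact hA1 z) convex_univ trivial trivial
    exact this
  have hGlow : ∀ w, |p w - E| ≤ ε₁ / 2 → 13 * E / 16 - h w.1 ≤ fderiv ℝ G' w (X w) := by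
    intro w hw
    have := hG'd w (7 * E / 8 - h w.1 - E / 32) (by
      intro v hv
      have a1 : ‖v.1 - w.1‖ ≤ κ := (norm_fst_le (v - w)).trans hv
      have a2 : ‖v.2 - w.2‖ ≤ κ := (norm_snd_le (v - w)).trans hv
      have a3 : h v.1 - h w.1 ≤ E / 32 := by
        have e1 := hKh.dist_le_mul v w
        rw [Real.dist_eq, dist_eq_norm] at e1
        have e2 := mul_le_mul_of_nonneg_left hv Kh.coe_nonneg
        exact (le_abs_self _).trans (e1.trans (e2.trans hκ3))
      have a4 : |p v - E| ≤ ε₁ := by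
        have e1 : |p v - p w| ≤ ε₁ / 2 := by
          have f1 := hV₁lip v.1 w.1
          have f2 := hξQ w (by linarith)
          have f3 : |‖v.2‖ - ‖w.2‖| ≤ κ := (abs_norm_sub_norm_le _ _).trans a2
          have f4 : ‖v.2‖ + ‖w.2‖ ≤ 2 * Q + 1 := by
            have := (abs_le.1 f3).2
            linarith
          have f5 : p v - p w = (‖v.2‖ - ‖w.2‖) * (‖v.2‖ + ‖w.2‖) + (V₁ v.1 - V₁ w.1) := by
            rw [hp, hp]; ring
          rw [f5]
          calc _ ≤ |(‖v.2‖ - ‖w.2‖) * (‖v.2‖ + ‖w.2‖)| + |V₁ v.1 - V₁ w.1| := abs_add_le _ _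
            _ ≤ κ * (2 * Q + 1) + A * κ := by
              rw [abs_mul]
              refine add_le_add (mul_le_mul f3 ?_ (abs_nonneg _) hκ.le)
                (f1.trans (mul_le_mul_of_nonneg_left a1 hA))
              rw [abs_of_nonneg (by positivity)]; exact f4
            _ ≤ ε₁ / 2 := by linarith
        have e2 : p v - E = (p v - p w) + (p w - E) := by ring
        rw [e2]
        exact (abs_add_le _ _).trans (by linarith)
      have a5 := havg v a4
      linarith)
    linarith
  -- the cutoff
  let χ : ContDiffBump (0 : H × H) := ⟨1, 2, by norm_num, by norm_num⟩
  obtain ⟨Kχ, hKχ⟩ : ∃ Kχ : NNReal, LipschitzWith Kχ χ :=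
    ⟨_, (ContDiff.lipschitzWith_of_hasCompactSupport χ.hasCompactSupport
      (χ.contDiff (n := 1)) (by simp)).choose_spec⟩
  set M : ℝ := 2 * R + Q + 1 + 16 / E * (B' * Kχ * (2 * Q + A)) with hM
  have hN0 : 0 ≤ B' * Kχ * (2 * Q + A) := by positivity
  have hN1 : 0 ≤ 16 / E * (B' * Kχ * (2 * Q + A)) := by positivity
  have hMpos : 0 < M := by positivity
  have hMN : B' * Kχ * (2 * Q + A) ≤ E / 16 * M := by
    have : E / 16 * (16 / E * (B' * Kχ * (2 * Q + A))) = B' * Kχ * (2 * Q + A) := by field_simp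
    rw [← this]
    refine mul_le_mul_of_nonneg_left ?_ (by positivity)
    linarith
  let θ : H × H → ℝ := fun w => χ (M⁻¹ • w)
  have hθs : ContDiff ℝ (⊤ : ℕ∞) θ := χ.contDiff.comp (contDiff_const_smul M⁻¹)
  have hθc : HasCompactSupport θ := by
    have := χ.hasCompactSupport.comp_homeomorph (Homeomorph.smulOfNeZero M⁻¹ (inv_ne_zero hMpos.ne'))
    exact this
  have hθlip : LipschitzWith (Kχ * ‖M⁻¹‖₊) θ := hKχ.comp (lipschitzWith_smul M⁻¹)
  refine ⟨ε₁ / 4, by positivity, C, hCpos.le, fun w => θ w * G' w, hθs.mul hG's,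
    hθc.mul_right, ?_⟩
  intro w hw
  have hw1 : |p w - E| ≤ ε₁ / 2 := by linarith
  have hw2 : |p w - E| ≤ ε₁ := by linarith
  have hθd : DifferentiableAt ℝ θ w := hθs.differentiable (by simp) w
  have hG'd' : DifferentiableAt ℝ G' w := hG's.differentiable (by simp) w
  have hfd : fderiv ℝ (fun w => θ w * G' w) w (X w) =
      θ w * fderiv ℝ G' w (X w) + G' w * fderiv ℝ θ w (X w) := by
    rw [fderiv_fun_mul hθd hG'd']
    simp
  have hXn : ‖X w‖ ≤ 2 * Q + A := by
    have e1 := hξQ w hw2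
    have e2 := hA1 w.1
    refine (Prod.norm_def _).le.trans (max_le ?_ ?_)
    · change ‖(2:ℝ) • w.2‖ ≤ _
      rw [norm_smul]; simp; linarith
    · change ‖-gradient V₁ w.1‖ ≤ _
      rw [norm_neg]; linarith
  have herr : |G' w * fderiv ℝ θ w (X w)| ≤ E / 16 := by
    have e1 : ‖fderiv ℝ θ w‖ ≤ Kχ * M⁻¹ := by
      have := norm_fderiv_le_of_lipschitz ℝ hθlip (x₀ := w)
      simpa [abs_of_pos hMpos] using this
    have e2 : |fderiv ℝ θ w (X w)| ≤ Kχ * M⁻¹ * (2 * Q + A) :=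
      ((fderiv ℝ θ w).le_opNorm (X w)).trans (mul_le_mul e1 hXn (norm_nonneg _) (by positivity))
    rw [abs_mul]
    calc _ ≤ B' * (Kχ * M⁻¹ * (2 * Q + A)) := mul_le_mul (hG'b w) e2 (abs_nonneg _) hB'0
      _ = (B' * Kχ * (2 * Q + A)) / M := by rw [div_eq_mul_inv]; ring
      _ ≤ E / 16 := by rw [div_le_iff₀ hMpos]; exact hMN
  have hθ0 : 0 ≤ θ w := χ.nonneg
  have hθ1 : θ w ≤ 1 := χ.le_one
  have hcut : (1 - θ w) * E ≤ (1 - θ w) * h w.1 := by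
    by_cases hc : ‖w‖ ≤ M
    · have : θ w = 1 := by
        refine χ.one_of_mem_closedBall ?_
        rw [mem_closedBall_zero_iff, norm_smul, norm_inv, Real.norm_eq_abs, abs_of_pos hMpos,
          inv_mul_le_iff₀ hMpos]
        simpa [χ] using hc
      rw [this]; simp
    · push Not at hc
      refine mul_le_mul_of_nonneg_left (hout _ ?_) (by linarith)
      by_contra hcon
      push Not at hcon
      have := hξQ w hw2
      have : ‖w‖ ≤ M := (Prod.norm_def _).le.trans (max_le (by linarith) (by linarith))
      linarith
  have hG'w := mul_le_mul_of_nonneg_left (hGlow w hw1) hθ0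
  have hpw := (abs_le.1 hw1).1
  rw [hp] at hpw
  have hupw := hup w.1
  have herr' := (abs_le.1 herr).1
  change E / 2 ≤ 2 * ‖w.2‖ ^ 2 - ⟪w.1, gradient V₁ w.1⟫ +
    fderiv ℝ (fun w => θ w * G' w) w (X w) + C * V₂ w.1
  rw [hfd]
  nlinarith

/-- Let `V₂` be smooth, nonnegative, with bounded derivatives of every
order and `V₂(x) → 0` as `|x| → ∞`, and `O = {(x,ξ) : V₂(x) > 0}`. Let `E > 0` and assume
every bounded trajectory of energy `E` meets `O`. Then there exist `ε > 0`, `c₀ > 0` with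
`2c₀ = min(1, E/2)`, `C_V ≥ 0` and a smooth compactly supported `r : ℝⁿ × ℝⁿ → ℝ` such that
`{p, b + r}(x,ξ) + C_V V₂(x) ≥ 2c₀` whenever `p(x,ξ) ∈ [E−2ε, E+2ε]`, where `b(x,ξ) = x·ξ`
and `{p, a}(x,ξ) = 2ξ·∇ₓa − ∇V₁(x)·∇_ξ a`. -/
theorem stmt_19
    (n : ℕ) (hn : 1 ≤ n) (ρ : ℝ) (hρ : 0 < ρ)
    (V₁ : EuclideanSpace ℝ (Fin n) → ℝ)
    (hV₁ : ContDiff ℝ (⊤ : ℕ∞) V₁)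
    (hV₁decay : ∀ k : ℕ, ∃ C : ℝ, 0 ≤ C ∧ ∀ x,
      ‖iteratedFDeriv ℝ k V₁ x‖ ≤ C * (1 + ‖x‖ ^ 2) ^ ((-ρ - (k : ℝ)) / 2))
    (p : EuclideanSpace ℝ (Fin n) × EuclideanSpace ℝ (Fin n) → ℝ)
    (hp : ∀ w, p w = ‖w.2‖ ^ 2 + V₁ w.1)
    (φ : ℝ → EuclideanSpace ℝ (Fin n) × EuclideanSpace ℝ (Fin n) →
      EuclideanSpace ℝ (Fin n) × EuclideanSpace ℝ (Fin n))
    (hφ₀ : ∀ w, φ 0 w = w)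
    (hflow : ∀ w t, HasDerivAt (fun s => φ s w)
      ((2 : ℝ) • (φ t w).2, -gradient V₁ (φ t w).1) t)
    (V₂ : EuclideanSpace ℝ (Fin n) → ℝ) (hV₂smooth : ContDiff ℝ (⊤ : ℕ∞) V₂)
    (hV₂nonneg : ∀ x, 0 ≤ V₂ x)
    (hV₂derivbdd : ∀ k : ℕ, ∃ C : ℝ, ∀ x, ‖iteratedFDeriv ℝ k V₂ x‖ ≤ C)
    (hV₂lim : Tendsto V₂ (cocompact (EuclideanSpace ℝ (Fin n))) (nhds 0))
    (E : ℝ) (hE : 0 < E)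
    (hmeet : ∀ w, p w = E → (∃ M : ℝ, ∀ t : ℝ, ‖(φ t w).1‖ ≤ M) →
      ∃ t : ℝ, 0 < V₂ (φ t w).1) :
    ∃ ε : ℝ, 0 < ε ∧ ∃ c₀ : ℝ, 0 < c₀ ∧ 2 * c₀ = min 1 (E / 2) ∧
      ∃ C_V : ℝ, 0 ≤ C_V ∧
        ∃ r : EuclideanSpace ℝ (Fin n) × EuclideanSpace ℝ (Fin n) → ℝ,
          ContDiff ℝ (⊤ : ℕ∞) r ∧ HasCompactSupport r ∧
          ∀ x ξ : EuclideanSpace ℝ (Fin n),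
            p (x, ξ) ∈ Set.Icc (E - 2 * ε) (E + 2 * ε) →
              2 * c₀ ≤
                2 * ⟪ξ, gradient (fun y => ⟪y, ξ⟫ + r (y, ξ)) x⟫
                  - ⟪gradient V₁ x, gradient (fun η => ⟪x, η⟫ + r (x, η)) ξ⟫
                  + C_V * V₂ x := by
  have hbnd : ∀ k : ℕ, ∃ C : ℝ, ∀ x, ‖iteratedFDeriv ℝ k V₁ x‖ ≤ C := by
    intro k
    obtain ⟨C, hC, h⟩ := hV₁decay k
    refine ⟨C, fun x => (h x).trans ?_⟩
    have h1 : (1 + ‖x‖ ^ 2) ^ ((-ρ - (k : ℝ)) / 2) ≤ 1 :=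
      Real.rpow_le_one_of_one_le_of_nonpos (by nlinarith [sq_nonneg ‖x‖])
        (by have := Nat.cast_nonneg (α := ℝ) k; linarith)
    simpa using mul_le_mul_of_nonneg_left h1 hC
  obtain ⟨C2, hC2⟩ := hbnd 2
  obtain ⟨D0, hD0⟩ := hV₂derivbdd 0
  obtain ⟨D1, hD1⟩ := hV₂derivbdd 1
  obtain ⟨A, hA, hA0, hA1, hA2, R, hR, hPR⟩ := aux_decay ρ hρ V₁ hV₁decay E hE
  obtain ⟨ε, hε, C, hC, r, hrs, hrc, hr⟩ := aux_core V₁ V₂ hV₁ p hp φ hφ₀ hflow _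
    (aux_grad_lip V₁ hV₁ C2 hC2) hV₂nonneg _ (aux_lip_of_iter V₂ hV₂smooth D1 hD1) D0
    (fun x => by
      have := hD0 x
      rw [norm_iteratedFDeriv_zero] at this
      exact (le_abs_self _).trans this) E hE hmeet A hA hA0 hA1 hA2 R hR hPR
  refine ⟨ε, hε, min 1 (E / 2) / 2, by positivity, by ring, C, hC, r, hrs, hrc, ?_⟩
  intro x ξ hpx
  have h1 := hr (x, ξ) (abs_le.2 ⟨by linarith [hpx.1], by linarith [hpx.2]⟩)
  have hrd : HasFDerivAt r (fderiv ℝ r (x, ξ)) (x, ξ) :=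
    (hrs.differentiable (by simp) (x, ξ)).hasFDerivAt
  have g1 : ⟪ξ, gradient (fun y => ⟪y, ξ⟫ + r (y, ξ)) x⟫ = ‖ξ‖ ^ 2 + fderiv ℝ r (x, ξ) (ξ, 0) := by
    have d1 : HasFDerivAt (fun y => r (y, ξ)) _ x :=
      hrd.comp (f := fun y => (y, ξ)) x (hasFDerivAt_prodMk_left x ξ)
    have d2 : HasFDerivAt (fun y : EuclideanSpace ℝ (Fin n) => ⟪y, ξ⟫) (innerSL ℝ ξ) x := by
      have : (fun y : EuclideanSpace ℝ (Fin n) => ⟪y, ξ⟫) = fun y => innerSL ℝ ξ y := by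
        funext y; simp [real_inner_comm]
      rw [this]
      exact (innerSL ℝ ξ).hasFDerivAt
    rw [real_inner_comm, inner_gradient_left, (d2.fun_add d1).fderiv]
    simp
  have g2 : ⟪gradient V₁ x, gradient (fun η => ⟪x, η⟫ + r (x, η)) ξ⟫ =
      ⟪x, gradient V₁ x⟫ + fderiv ℝ r (x, ξ) (0, gradient V₁ x) := by
    have d1 : HasFDerivAt (fun y => r (x, y)) _ ξ :=
      hrd.comp (f := fun y => (x, y)) ξ (hasFDerivAt_prodMk_right x ξ)
    have d2 : HasFDerivAt (fun y : EuclideanSpace ℝ (Fin n) => ⟪x, y⟫) (innerSL ℝ x) ξ :=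
      (innerSL ℝ x).hasFDerivAt
    rw [real_inner_comm, inner_gradient_left, (d2.fun_add d1).fderiv]
    simp
  have g3 : fderiv ℝ r (x, ξ) ((2:ℝ) • ξ, -gradient V₁ x) =
      2 * fderiv ℝ r (x, ξ) (ξ, 0) - fderiv ℝ r (x, ξ) (0, gradient V₁ x) := by
    have : (((2:ℝ) • ξ, -gradient V₁ x) : EuclideanSpace ℝ (Fin n) × EuclideanSpace ℝ (Fin n)) =
        (2:ℝ) • (ξ, 0) - (0, gradient V₁ x) := by
      simp
    rw [this, map_sub, map_smul, smul_eq_mul]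
  simp only [] at h1
  rw [g3] at h1
  rw [g1, g2]
  have := min_le_right 1 (E / 2)
  linarith
end
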